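/- arXiv:1503.03246 — 2 statements merged into one kernel-verified Lean document; each statement's English description precedes it below -/
import Mathlib

section
/- For every t ∈ (0,∞] there exists a compact metric space X and a homeomorphism T : X → X whose topological entropy equals t, such that the topological entropy of F_T on H(X,X) is zero. -/
open Set Filter Topology

/-- `E` is an `(n, ε)`-separated set for the map `S`: any two distinct points of `E` are more
than `ε` apart in the dynamical metric `max_{0 ≤ j < n} dist (S^j x) (S^j y)`. -/
def IsDynSep {Z : Type*} [PseudoMetricSpace Z] (S : Z → Z) (n : ℕ) (ε : ℝ) (E : Set Z) : Prop :=
  ∀ x ∈ E, ∀ y ∈ E, x ≠ y → ∃ j < n, ε < dist (S^[j] x) (S^[j] y)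

/-- The maximal cardinality `sep(n, ε; K)` of an `(n, ε)`-separated subset of `K`. -/
noncomputable def sepNum {Z : Type*} [PseudoMetricSpace Z] (S : Z → Z) (n : ℕ) (ε : ℝ)
    (K : Set Z) : ℕ :=
  sSup {m : ℕ | ∃ E : Finset Z, ↑E ⊆ K ∧ IsDynSep S n ε ↑E ∧ E.card = m}

/-- The topological entropy of `S` on the set `K`:
`lim_{ε → 0} limsup_n (1/n) log sep(n, ε; K)`; the limit as `ε → 0` is realized as the
supremum over `ε > 0`, the quantity being monotone in `ε`. -/
noncomputable def entropyOnSet {Z : Type*} [PseudoMetricSpace Z] (S : Z → Z) (K : Set Z) :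
    EReal :=
  ⨆ (ε : ℝ) (_ : 0 < ε),
    Filter.atTop.limsup fun n : ℕ => ((Real.log (sepNum S n ε K) / n : ℝ) : EReal)

/-- The topological entropy of the restriction of `S` to a subset `A` of its domain:
the supremum of the entropies on all compact subsets of `A`. -/
noncomputable def entropyOn {Z : Type*} [PseudoMetricSpace Z] (S : Z → Z) (A : Set Z) : EReal :=
  ⨆ (K : Set Z) (_ : IsCompact K) (_ : K ⊆ A), entropyOnSet S K

/-- The topological entropy of `S`: the supremum of the entropies on all compact sets. -/
noncomputable def dynEntropy {Z : Type*} [PseudoMetricSpace Z] (S : Z → Z) : EReal :=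
  ⨆ (K : Set Z) (_ : IsCompact K), entropyOnSet S K

/-- The set `H(X,X)` of self-homeomorphisms of `X`, viewed inside `C(X,X)` (so that, for `X`
compact metric, it inherits the uniform metric `D(φ,ψ) = sup_x d(φ x, ψ x)`). -/
def HSet (X : Type*) [TopologicalSpace X] : Set C(X, X) := {f | IsHomeomorph f}

/-- The functional envelope map `F_T : φ ↦ T ∘ φ` on `C(X,X)`. -/
def envMap {X : Type*} [TopologicalSpace X] (T : X ≃ₜ X) : C(X, X) → C(X, X) :=
  fun φ => (T : C(X, X)).comp φ


/-! ### General facts on separated sets -/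

theorem sepNum_le_of {Z : Type*} [PseudoMetricSpace Z] (S : Z → Z) (n : ℕ) (ε : ℝ)
    (K : Set Z) {C : Type*} (code : Z → C) (A : Finset C) (hA : ∀ x ∈ K, code x ∈ A)
    (hc : ∀ x ∈ K, ∀ y ∈ K, code x = code y → ∀ j < n, dist (S^[j] x) (S^[j] y) ≤ ε) :
    sepNum S n ε K ≤ A.card := by
  unfold sepNum
  apply csSup_le'
  rintro m ⟨E, hEK, hE, rfl⟩
  apply Finset.card_le_card_of_injOn code
  · intro x hx
    exact hA x (hEK hx)
  · intro x hx y hy hxy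
    by_contra hne
    obtain ⟨j, hj, hj'⟩ := hE x hx y hy hne
    exact absurd (hc x (hEK hx) y (hEK hy) hxy j hj) (not_le.mpr hj')

theorem bddAbove_sep {Z : Type*} [PseudoMetricSpace Z] [CompactSpace Z] (S : Z → Z)
    (hS : Continuous S) (n : ℕ) {ε : ℝ} (hε : 0 < ε) (K : Set Z) :
    BddAbove {m : ℕ | ∃ E : Finset Z, ↑E ⊆ K ∧ IsDynSep S n ε ↑E ∧ E.card = m} := by
  classical
  have hU : ∀ x : Z, {y | ∀ j ∈ Finset.range n, dist (S^[j] x) (S^[j] y) < ε / 2} ∈ 𝓝 x := by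
    intro x
    have : ∀ j ∈ Finset.range n, ∀ᶠ y in 𝓝 x, dist (S^[j] x) (S^[j] y) < ε / 2 := by
      intro j _
      have hc : Continuous fun y => dist (S^[j] x) (S^[j] y) :=
        continuous_const.dist (hS.iterate j)
      have := hc.tendsto x
      simp only [dist_self] at this
      exact this.eventually (gt_mem_nhds (by linarith))
    exact (Filter.eventually_all_finset _).2 this
  obtain ⟨t, -, ht⟩ := (isCompact_univ (X := Z)).elim_nhds_subcover _ (fun x _ => hU x)
  have ht' : ∀ y : Z, ∃ x ∈ t, ∀ j ∈ Finset.range n, dist (S^[j] x) (S^[j] y) < ε / 2 := by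
    intro y
    have := ht (mem_univ y)
    simpa using this
  choose code hcode hcode' using ht'
  refine ⟨t.card, ?_⟩
  rintro m ⟨E, hEK, hE, rfl⟩
  apply Finset.card_le_card_of_injOn code
  · intro x hx
    exact hcode x
  · intro x hx y hy hxy
    by_contra hne
    obtain ⟨j, hj, hj'⟩ := hE x hx y hy hne
    have h1 := hcode' x j (Finset.mem_range.2 hj)
    have h2 := hcode' y j (Finset.mem_range.2 hj)
    rw [hxy] at h1
    have h3 := dist_triangle_left (S^[j] x) (S^[j] y) (S^[j] (code y))
    linarith

theorem le_sepNum_of {Z : Type*} [PseudoMetricSpace Z] [CompactSpace Z] (S : Z → Z)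
    (hS : Continuous S) (n : ℕ) {ε : ℝ} (hε : 0 < ε) {W : Type*} [Fintype W] (p : W → Z)
    (hp : ∀ v w, v ≠ w → ∃ j < n, ε < dist (S^[j] (p v)) (S^[j] (p w))) :
    Fintype.card W ≤ sepNum S n ε univ := by
  classical
  have hinj : Function.Injective p := by
    intro v w hvw
    by_contra hne
    obtain ⟨j, -, hj⟩ := hp v w hne
    rw [hvw, dist_self] at hj
    linarith
  apply le_csSup (bddAbove_sep S hS n hε univ)
  refine ⟨Finset.univ.image p, by simp, ?_, ?_⟩
  · intro x hx y hy hxy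
    simp only [Finset.coe_image, Finset.coe_univ, image_univ, mem_range] at hx hy
    obtain ⟨v, rfl⟩ := hx
    obtain ⟨w, rfl⟩ := hy
    exact hp v w (fun h => hxy (by rw [h]))
  · rw [Finset.card_image_of_injective _ hinj, Finset.card_univ]

theorem entropyOnSet_nonneg {Z : Type*} [PseudoMetricSpace Z] (S : Z → Z) (K : Set Z) :
    0 ≤ entropyOnSet S K := by
  unfold entropyOnSet
  refine le_trans ?_ (le_iSup₂ (f := fun (ε : ℝ) (_ : 0 < ε) => Filter.atTop.limsup
    fun n : ℕ => ((Real.log (sepNum S n ε K) / n : ℝ) : EReal)) (1 : ℝ) one_pos)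
  apply Filter.le_limsup_of_frequently_le'
  refine (Filter.Eventually.of_forall ?_).frequently
  intro n
  have : 0 ≤ Real.log (sepNum S n 1 K) / n := by
    apply div_nonneg (Real.log_natCast_nonneg _) (Nat.cast_nonneg _)
  exact_mod_cast this

theorem log_natCast_mono {a b : ℕ} (h : a ≤ b) : Real.log a ≤ Real.log b := by
  rcases Nat.eq_zero_or_pos a with h0 | h0
  · rw [h0]
    simpa using Real.log_natCast_nonneg b
  · exact Real.log_le_log (by exact_mod_cast h0) (by exact_mod_cast h)

/-! ### Circle facts -/

theorem dist_circle (x y : ℝ) :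
    dist (x : UnitAddCircle) (y : UnitAddCircle) = |(x - y) - round (x - y)| := by
  rw [dist_eq_norm, ← UnitAddCircle.norm_eq]
  rfl

theorem circle_eq_int {x y : ℝ} (h : (x : UnitAddCircle) = (y : UnitAddCircle)) :
    ∃ k : ℤ, x - y = k := by
  have h1 := dist_circle x y
  rw [h, dist_self] at h1
  exact ⟨round (x - y), by
    have := abs_eq_zero.1 h1.symm
    linarith⟩

/-! ### The envelope of a flow-like map with an open dense line has zero entropy -/

/-- A continuous image of a line meeting the open dense line stays inside it. -/
theorem line_stays {X : Type*} [MetricSpace X] (l : ℝ → X) (π : X → UnitAddCircle)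
    (hπ : Continuous π) (hl : IsOpenEmbedding l) (hπl : ∀ r, π (l r) = (r : UnitAddCircle))
    (γ : ℝ → X) (hγ : Continuous γ) (r₀ : ℝ) (h₀ : γ r₀ ∈ range l) (r : ℝ) :
    γ r ∈ range l := by
  have hopen : IsOpen (γ ⁻¹' range l) := hl.isOpen_range.preimage hγ
  have hclosed : IsClosed (γ ⁻¹' range l) := by
    rw [← closure_subset_iff_isClosed]
    intro r₁ hr₁
    have hc : Continuous fun r => dist (π (γ r)) (π (γ r₁)) :=
      (hπ.comp hγ).dist continuous_const
    have hc' : ∀ᶠ r in 𝓝 r₁, dist (π (γ r)) (π (γ r₁)) < 1 / 4 := by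
      have := hc.tendsto r₁
      simp only [dist_self] at this
      exact this.eventually (gt_mem_nhds (by norm_num))
    obtain ⟨δ, hδ, hball⟩ := Metric.eventually_nhds_iff_ball.1 hc'
    obtain ⟨r₂, hr₂, hr₂'⟩ := Metric.mem_closure_iff.1 hr₁ δ hδ
    obtain ⟨y, hy⟩ := hr₂
    obtain ⟨θ, hθ⟩ : ∃ θ : ℝ, (θ : UnitAddCircle) = π (γ r₁) :=
      QuotientAddGroup.mk_surjective _
    have hnear : ∀ r ∈ Metric.ball r₁ δ, ∀ z, l z = γ r →
        |(z - θ) - round (z - θ)| < 1 / 4 := by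
      intro r hr z hz
      have := hball r hr
      rwa [← hz, hπl, ← hθ, dist_circle] at this
    have hr₂b : r₂ ∈ Metric.ball r₁ δ := by rwa [Metric.mem_ball, dist_comm]
    have hy1 := hnear r₂ hr₂b y hy
    set k : ℤ := round (y - θ) with hk
    have hJo : IsOpen (l '' Ioo (θ + k - 1 / 4) (θ + k + 1 / 4)) :=
      hl.isOpenMap _ isOpen_Ioo
    have hJc : IsClosed (l '' Icc (θ + k - 1 / 4) (θ + k + 1 / 4)) :=
      (isCompact_Icc.image hl.continuous).isClosed
    have hsub : Metric.ball r₁ δ ⊆ γ ⁻¹' (l '' Ioo (θ + k - 1 / 4) (θ + k + 1 / 4)) := by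
      refine (convex_ball r₁ δ).isPreconnected.subset_left_of_subset_union
        (hJo.preimage hγ) (hJc.isOpen_compl.preimage hγ) ?_ ?_ ?_
      · rw [Set.disjoint_left]
        rintro r ⟨z, hz, hz'⟩ hr
        exact hr ⟨z, Ioo_subset_Icc_self hz, hz'⟩
      · intro r hr
        by_cases hin : γ r ∈ l '' Icc (θ + k - 1 / 4) (θ + k + 1 / 4)
        · left
          obtain ⟨z, hz, hz'⟩ := hin
          have h1 := hnear r hr z hz'
          have h2 : round (z - θ) = k := by
            rw [round_eq, Int.floor_eq_iff]
            constructor <;> linarith [hz.1, hz.2]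
          rw [h2, abs_lt] at h1
          exact ⟨z, ⟨by linarith [h1.1], by linarith [h1.2]⟩, hz'⟩
        · right
          exact hin
      · refine ⟨r₂, hr₂b, y, ?_, hy⟩
        rw [abs_lt] at hy1
        exact ⟨by linarith [hy1.1], by linarith [hy1.2]⟩
    obtain ⟨z, -, hz⟩ := hsub (Metric.mem_ball_self hδ)
    exact ⟨z, hz⟩
  have huniv := (show IsClopen (γ ⁻¹' range l) from ⟨hclosed, hopen⟩).eq_univ ⟨r₀, h₀⟩
  have : r ∈ γ ⁻¹' range l := by rw [huniv]; trivial
  exact this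

theorem homeo_preserves_line {X : Type*} [MetricSpace X] (l : ℝ → X) (π : X → UnitAddCircle)
    (hπ : Continuous π) (hl : IsOpenEmbedding l) (hd : DenseRange l)
    (hπl : ∀ r, π (l r) = (r : UnitAddCircle)) (φ : X → X) (hφ : IsHomeomorph φ) (r : ℝ) :
    φ (l r) ∈ range l := by
  have ho : IsOpen (φ '' range l) := hφ.isOpenMap _ hl.isOpen_range
  obtain ⟨x, hx, hx'⟩ := hd.inter_open_nonempty _ ho ⟨φ (l 0), l 0, ⟨0, rfl⟩, rfl⟩
  obtain ⟨z, ⟨r₀, rfl⟩, rfl⟩ := hx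
  exact line_stays l π hπ hl hπl (fun r => φ (l r)) (hφ.continuous.comp hl.continuous) r₀ hx' r

theorem small_of_near_int (τ : ℝ → ℝ) (hτ : Continuous τ) {η : ℝ} (hη : η ≤ 1 / 4)
    (h0 : |τ 0| < η) (h : ∀ r, |τ r - round (τ r)| < η) (r : ℝ) : |τ r| < η := by
  have hlt : |τ r| < 1 / 4 := by
    by_contra hge
    push Not at hge
    have hc : Continuous fun r => |τ r| := hτ.abs
    obtain ⟨z, hz⟩ := mem_range_of_exists_le_of_exists_ge hc ⟨0, (h0.trans_le hη).le⟩ ⟨r, hge⟩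
    have h1 := h z
    have h2 : round (τ z) = 0 := by
      rw [round_eq, Int.floor_eq_iff]
      have := abs_le.1 (le_of_eq hz)
      push_cast
      constructor <;> linarith [this.1, this.2]
    rw [h2] at h1
    simp only [Int.cast_zero, sub_zero] at h1
    simp only at hz
    linarith
  have h2 : round (τ r) = 0 := by
    rw [round_eq, Int.floor_eq_iff]
    have := abs_lt.1 hlt
    push_cast
    constructor <;> linarith [this.1, this.2]
  have h1 := h r
  rw [h2] at h1
  simpa using h1

theorem envMap_iterate {X : Type*} [TopologicalSpace X] (T : X ≃ₜ X) (j : ℕ) (φ : C(X, X))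
    (x : X) : ((envMap T)^[j] φ) x = T^[j] (φ x) := by
  induction j with
  | zero => rfl
  | succ j ih =>
    rw [Function.iterate_succ_apply', Function.iterate_succ_apply', ← ih]
    rfl

theorem iterate_line {X : Type*} (T : X → X) (l : ℝ → X) (c : ℝ)
    (hT : ∀ r, T (l r) = l (r + c)) (j : ℕ) (r : ℝ) : T^[j] (l r) = l (r + c * j) := by
  induction j with
  | zero => simp
  | succ j ih =>
    rw [Function.iterate_succ_apply', ih, hT]
    congr 1
    push_cast
    ring

theorem env_equicont {X : Type*} [MetricSpace X] [CompactSpace X] (T : X ≃ₜ X) (l : ℝ → X)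
    (c : ℝ) (π : X → UnitAddCircle) (hπ : Continuous π) (hl : IsOpenEmbedding l)
    (hd : DenseRange l) (hu : UniformContinuous l) (hT : ∀ r, T (l r) = l (r + c))
    (hπl : ∀ r, π (l r) = (r : UnitAddCircle)) (K : Set C(X, X)) (hK : IsCompact K)
    (hKH : K ⊆ HSet X) {ε : ℝ} (hε : 0 < ε) :
    ∃ δ > 0, ∀ φ ∈ K, ∀ ψ ∈ K, dist φ ψ < δ →
      ∀ j : ℕ, dist ((envMap T)^[j] φ) ((envMap T)^[j] ψ) ≤ ε := by
  obtain ⟨η₀, hη₀, hη₀'⟩ := Metric.uniformContinuous_iff.1 hu ε hε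
  set η := min η₀ (1 / 4) with hη
  have hηpos : 0 < η := lt_min hη₀ (by norm_num)
  have hmem : ∀ φ ∈ K, ∀ r, ∃ s, l s = φ (l r) := fun φ hφ r =>
    homeo_preserves_line l π hπ hl hd hπl φ (hKH hφ) r
  choose! h hh using hmem
  -- continuity of the lifted maps
  have hcont : ∀ φ ∈ K, Continuous (h φ) := by
    intro φ hφ
    rw [hl.isInducing.continuous_iff]
    have : l ∘ h φ = fun r => φ (l r) := funext fun r => hh φ hφ r
    rw [this]
    exact φ.continuous.comp hl.continuous
  have hev : ContinuousOn (fun φ => h φ 0) K := by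
    rw [hl.isInducing.continuousOn_iff]
    have h1 : ContinuousOn (fun φ : C(X, X) => φ (l 0)) K :=
      (continuous_eval_const (l 0)).continuousOn
    exact h1.congr fun φ hφ => hh φ hφ 0
  have huev := hK.uniformContinuousOn_of_continuous hev
  obtain ⟨δ₁, hδ₁, hδ₁'⟩ := Metric.uniformContinuousOn_iff.1 huev η hηpos
  have huπ := CompactSpace.uniformContinuous_of_continuous hπ
  obtain ⟨δ₂, hδ₂, hδ₂'⟩ := Metric.uniformContinuous_iff.1 huπ η hηpos
  refine ⟨min δ₁ δ₂, lt_min hδ₁ hδ₂, ?_⟩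
  intro φ hφ ψ hψ hD j
  have hsmall : ∀ r, |h φ r - h ψ r| < η := by
    refine small_of_near_int (fun r => h φ r - h ψ r) ((hcont φ hφ).sub (hcont ψ hψ))
      (min_le_right _ _) ?_ ?_
    · have := hδ₁' φ hφ ψ hψ (hD.trans_le (min_le_left _ _))
      rwa [Real.dist_eq] at this
    · intro r
      have h1 : dist (φ (l r)) (ψ (l r)) < δ₂ :=
        (ContinuousMap.dist_apply_le_dist _).trans_lt (hD.trans_le (min_le_right _ _))
      have h2 := hδ₂' h1
      rwa [← hh φ hφ, ← hh ψ hψ, hπl, hπl, dist_circle] at h2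
  rw [ContinuousMap.dist_le hε.le]
  intro x
  have hclosed : IsClosed {x | dist (((envMap T)^[j] φ) x) (((envMap T)^[j] ψ) x) ≤ ε} :=
    isClosed_le (((envMap T)^[j] φ).continuous.dist ((envMap T)^[j] ψ).continuous)
      continuous_const
  refine hd.induction_on x hclosed ?_
  intro r
  rw [envMap_iterate, envMap_iterate, ← hh φ hφ, ← hh ψ hψ, iterate_line T l c hT,
    iterate_line T l c hT]
  refine (hη₀' ?_).le
  rw [Real.dist_eq]
  have h1 := hsmall r
  have h2 : h φ r + c * j - (h ψ r + c * j) = h φ r - h ψ r := by ring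
  rw [h2]
  exact h1.trans_le (min_le_left _ _)

theorem env_zero {X : Type*} [MetricSpace X] [CompactSpace X] (T : X ≃ₜ X) (l : ℝ → X)
    (c : ℝ) (π : X → UnitAddCircle) (hπ : Continuous π) (hl : IsOpenEmbedding l)
    (hd : DenseRange l) (hu : UniformContinuous l) (hT : ∀ r, T (l r) = l (r + c))
    (hπl : ∀ r, π (l r) = (r : UnitAddCircle)) :
    entropyOn (envMap T) (HSet X) = 0 := by
  classical
  apply le_antisymm
  · unfold entropyOn
    refine iSup_le fun K => iSup_le fun hK => iSup_le fun hKH => ?_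
    unfold entropyOnSet
    refine iSup_le fun ε => iSup_le fun hε => ?_
    obtain ⟨δ, hδ, hδ'⟩ := env_equicont T l c π hπ hl hd hu hT hπl K hK hKH hε
    obtain ⟨t, -, htf, ht⟩ := hK.finite_cover_balls (e := δ / 2) (by linarith)
    have ht' : ∀ φ ∈ K, ∃ f ∈ t, dist φ f < δ / 2 := by
      intro φ hφ
      have := ht hφ
      simpa using this
    choose! code hcode hcode' using ht'
    have hb : ∀ n, sepNum (envMap T) n ε K ≤ htf.toFinset.card := by
      intro n
      refine sepNum_le_of _ n ε K code htf.toFinset (fun x hx => by simpa using hcode x hx) ?_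
      intro φ hφ ψ hψ hφψ j _
      apply hδ' φ hφ ψ hψ
      have h1 := hcode' φ hφ
      have h2 := hcode' ψ hψ
      rw [hφψ] at h1
      linarith [dist_triangle_right φ ψ (code ψ)]
    have hlim : Tendsto (fun n : ℕ => (((Real.log htf.toFinset.card) / n : ℝ) : EReal)) atTop
        (𝓝 ((0 : ℝ) : EReal)) :=
      (continuous_coe_real_ereal.tendsto _).comp
        (tendsto_const_nhds.div_atTop tendsto_natCast_atTop_atTop)
    rw [EReal.coe_zero] at hlim
    rw [← hlim.limsup_eq]
    refine limsup_le_limsup (Eventually.of_forall fun n => ?_)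
    apply EReal.coe_le_coe_iff.2
    exact div_le_div_of_nonneg_right (log_natCast_mono (hb n)) (Nat.cast_nonneg n)
  · unfold entropyOn
    refine le_trans (entropyOnSet_nonneg (envMap T) ∅) ?_
    exact le_iSup_of_le ∅ (le_iSup_of_le isCompact_empty
      (le_iSup_of_le (empty_subset _) le_rfl))

/-! ### The line, and the space it generates -/

/-- The letters: a marker `-1` at position `0`, elsewhere values in `(0,1]`. -/
noncomputable def letter (s : ℤ → ℕ) (k : ℤ) : ℝ := if k = 0 then -1 else 1 / ((s k : ℝ) + 1)

theorem abs_letter_le (s : ℤ → ℕ) (k : ℤ) : |letter s k| ≤ 1 := by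
  unfold letter
  split_ifs
  · simp
  · have h : (0 : ℝ) ≤ s k := Nat.cast_nonneg _
    rw [abs_of_nonneg (by positivity), div_le_one (by positivity)]
    linarith

/-- Distance to the nearest integer. -/
noncomputable def saw (r : ℝ) : ℝ := |r - round r|

theorem saw_nonneg (r : ℝ) : 0 ≤ saw r := abs_nonneg _

theorem saw_le (r : ℝ) (k : ℤ) : saw r ≤ |r - k| := round_le r k

theorem saw_lip (r r' : ℝ) : |saw r - saw r'| ≤ |r - r'| := by
  have h1 := saw_le r (round r')
  have h2 := saw_le r' (round r)
  unfold saw at *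
  have h3 : |r - round r'| ≤ |r - r'| + |r' - round r'| := by
    have := abs_add_le (r - r') (r' - round r')
    rwa [sub_add_sub_cancel] at this
  have h4 : |r' - round r| ≤ |r' - r| + |r - round r| := by
    have := abs_add_le (r' - r) (r - round r)
    rwa [sub_add_sub_cancel] at this
  rw [abs_sub_comm r' r] at h4
  rw [abs_le]
  constructor <;> linarith

theorem saw_add_int (r : ℝ) (k : ℤ) : saw (r + k) = saw r := by
  unfold saw
  rw [round_add_intCast]
  push_cast
  congr 1
  ring

theorem saw_pos {r : ℝ} (h0 : 0 < r) (h1 : r < 1) : 0 < saw r := by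
  refine lt_of_le_of_ne (saw_nonneg r) fun h => ?_
  unfold saw at h
  have h2 := abs_eq_zero.1 h.symm
  have h3 : r = round r := by linarith
  rw [h3] at h0 h1
  have h4 : (0 : ℤ) < round r := by exact_mod_cast h0
  have h5 : round r < (1 : ℤ) := by exact_mod_cast h1
  omega

theorem saw_ge {r : ℝ} (h0 : 1 / 4 ≤ r) (h1 : r ≤ 3 / 4) : 1 / 4 ≤ saw r := by
  unfold saw
  rcases le_or_gt (round r) 0 with h | h
  · have : (round r : ℝ) ≤ 0 := by exact_mod_cast h
    exact le_trans (by linarith) (le_abs_self _)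
  · have : (1 : ℝ) ≤ round r := by exact_mod_cast h
    exact le_trans (by linarith) (neg_le_abs _)

/-- The height function along the line. -/
noncomputable def hgt (s : ℤ → ℕ) (r : ℝ) : ℝ := letter s ⌊r⌋ * saw r

theorem abs_hgt_le_saw (s : ℤ → ℕ) (r : ℝ) : |hgt s r| ≤ saw r := by
  unfold hgt
  rw [abs_mul, abs_of_nonneg (saw_nonneg r)]
  exact mul_le_of_le_one_left (saw_nonneg r) (abs_letter_le s _)

theorem abs_hgt_le (s : ℤ → ℕ) (r : ℝ) : |hgt s r| ≤ 1 := by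
  refine (abs_hgt_le_saw s r).trans ?_
  unfold saw
  linarith [abs_sub_round r]

theorem hgt_lip_aux (s : ℤ → ℕ) {r r' : ℝ} (h : r ≤ r') : |hgt s r - hgt s r'| ≤ |r - r'| := by
  by_cases hf : ⌊r⌋ = ⌊r'⌋
  · unfold hgt
    rw [hf, ← mul_sub, abs_mul]
    exact (mul_le_of_le_one_left (abs_nonneg _) (abs_letter_le s _)).trans (saw_lip r r')
  · have hlt : ⌊r⌋ < ⌊r'⌋ := lt_of_le_of_ne (Int.floor_mono h) hf
    have h1 : r < ⌊r'⌋ := Int.floor_lt.1 hlt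
    have h2 : (⌊r'⌋ : ℝ) ≤ r' := Int.floor_le r'
    have h3 := (abs_hgt_le_saw s r).trans (saw_le r ⌊r'⌋)
    have h4 := (abs_hgt_le_saw s r').trans (saw_le r' ⌊r'⌋)
    have h5 := abs_sub (hgt s r) (hgt s r')
    rw [abs_of_nonpos (by linarith : r - ⌊r'⌋ ≤ 0)] at h3
    rw [abs_of_nonneg (by linarith : 0 ≤ r' - ⌊r'⌋)] at h4
    rw [abs_of_nonpos (by linarith : r - r' ≤ 0)]
    linarith

theorem hgt_lip (s : ℤ → ℕ) (r r' : ℝ) : |hgt s r - hgt s r'| ≤ |r - r'| := by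
  rcases le_total r r' with h | h
  · exact hgt_lip_aux s h
  · rw [abs_sub_comm, abs_sub_comm r r']
    exact hgt_lip_aux s h

theorem hgt_uc (s : ℤ → ℕ) : UniformContinuous (hgt s) := by
  refine Metric.uniformContinuous_iff.2 fun ε hε => ⟨ε, hε, fun a b hab => ?_⟩
  exact (hgt_lip s a b).trans_lt hab

theorem hgt_neg_iff (s : ℤ → ℕ) (r : ℝ) : hgt s r < 0 ↔ 0 < r ∧ r < 1 := by
  constructor
  · intro h
    have hfl : ⌊r⌋ = 0 := by
      by_contra hne
      unfold hgt letter at h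
      rw [if_neg hne] at h
      have : 0 ≤ 1 / ((s ⌊r⌋ : ℝ) + 1) * saw r := mul_nonneg (by positivity) (saw_nonneg r)
      linarith
    have h1 := Int.floor_eq_iff.1 hfl
    push_cast at h1
    refine ⟨lt_of_le_of_ne h1.1 ?_, by linarith [h1.2]⟩
    rintro rfl
    simp [hgt, saw] at h
  · rintro ⟨h0, h1⟩
    have hfl : ⌊r⌋ = 0 := by
      rw [Int.floor_eq_iff]
      push_cast
      constructor <;> linarith
    unfold hgt letter
    rw [if_pos hfl]
    linarith [saw_pos h0 h1]

/-- The ambient space. -/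
abbrev Amb : Type := ℤ → ℝ × UnitAddCircle

noncomputable instance ambMetric : MetricSpace Amb := PiCountable.metricSpace

/-- The line in the ambient space. -/
noncomputable def line₀ (s : ℤ → ℕ) (c : ℝ) (r : ℝ) : Amb :=
  fun k => (hgt s (r + c * k), ((r + c * k : ℝ) : UnitAddCircle))

theorem coe_uc : UniformContinuous (fun r : ℝ => (r : UnitAddCircle)) := by
  refine Metric.uniformContinuous_iff.2 fun ε hε => ⟨ε, hε, fun a b hab => ?_⟩
  rw [dist_circle]
  refine lt_of_le_of_lt ?_ hab
  have := round_le (a - b) 0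
  simpa [Real.dist_eq] using this

theorem line₀_uc (s : ℤ → ℕ) (c : ℝ) : UniformContinuous (line₀ s c) := by
  refine uniformContinuous_pi.2 fun k => ?_
  have h : UniformContinuous fun r : ℝ => r + c * k :=
    uniformContinuous_id.add uniformContinuous_const
  exact ((hgt_uc s).comp h).prodMk (coe_uc.comp h)

/-- The space: the closure of the line. -/
abbrev Sp (s : ℤ → ℕ) (c : ℝ) : Type := closure (range (line₀ s c))

theorem isCompact_closure_line (s : ℤ → ℕ) (c : ℝ) : IsCompact (closure (range (line₀ s c))) := by
  have hc : IsCompact (Set.pi univ fun _ : ℤ => (Icc (-1 : ℝ) 1) ×ˢ (univ : Set UnitAddCircle)) :=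
    isCompact_univ_pi fun _ => isCompact_Icc.prod isCompact_univ
  refine hc.of_isClosed_subset isClosed_closure (closure_minimal ?_ hc.isClosed)
  rintro _ ⟨r, rfl⟩ k -
  exact ⟨abs_le.1 (abs_hgt_le s _), trivial⟩

instance spCompact (s : ℤ → ℕ) (c : ℝ) : CompactSpace (Sp s c) :=
  isCompact_iff_compactSpace.1 (isCompact_closure_line s c)

/-- The line in the space. -/
noncomputable def line (s : ℤ → ℕ) (c : ℝ) (r : ℝ) : Sp s c :=
  ⟨line₀ s c r, subset_closure ⟨r, rfl⟩⟩

theorem line_uc (s : ℤ → ℕ) (c : ℝ) : UniformContinuous (line s c) :=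
  (line₀_uc s c).subtype_mk _

theorem line_dense (s : ℤ → ℕ) (c : ℝ) : DenseRange (line s c) := by
  intro x
  rw [closure_subtype]
  have : ((↑) '' range (line s c) : Set Amb) = range (line₀ s c) := by
    rw [← range_comp]
    rfl
  rw [this]
  exact x.2

/-- The shift by `m` on the ambient space. -/
def shf (m : ℤ) (x : Amb) : Amb := fun k => x (k + m)

theorem shf_continuous (m : ℤ) : Continuous (shf m) :=
  continuous_pi fun k => continuous_apply (k + m)

theorem shf_line (s : ℤ → ℕ) (c : ℝ) (m : ℤ) (r : ℝ) :
    shf m (line₀ s c r) = line₀ s c (r + c * m) := by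
  funext k
  unfold shf line₀
  have : r + c * ((k + m : ℤ) : ℝ) = r + c * m + c * k := by
    push_cast
    ring
  rw [this]

theorem shf_mem (s : ℤ → ℕ) (c : ℝ) (m : ℤ) (x : Amb) (hx : x ∈ closure (range (line₀ s c))) :
    shf m x ∈ closure (range (line₀ s c)) := by
  refine map_mem_closure (shf_continuous m) hx ?_
  rintro _ ⟨r, rfl⟩
  exact ⟨_, (shf_line s c m r).symm⟩

/-- The homeomorphism. -/
def shiftHomeo (s : ℤ → ℕ) (c : ℝ) : Sp s c ≃ₜ Sp s c where
  toFun x := ⟨shf 1 x, shf_mem s c 1 x x.2⟩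
  invFun x := ⟨shf (-1) x, shf_mem s c (-1) x x.2⟩
  left_inv x := by
    apply Subtype.ext
    funext k
    simp [shf]
  right_inv x := by
    apply Subtype.ext
    funext k
    simp [shf]
  continuous_toFun := ((shf_continuous 1).comp continuous_subtype_val).subtype_mk _
  continuous_invFun := ((shf_continuous (-1)).comp continuous_subtype_val).subtype_mk _

theorem shiftHomeo_line (s : ℤ → ℕ) (c : ℝ) (r : ℝ) :
    shiftHomeo s c (line s c r) = line s c (r + c) := by
  apply Subtype.ext
  have := shf_line s c 1 r
  simp only [Int.cast_one, mul_one] at this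
  exact this

theorem coord_uc (s : ℤ → ℕ) (c : ℝ) (k : ℤ) :
    UniformContinuous fun x : Sp s c => (x : Amb) k :=
  (Pi.uniformContinuous_proj (fun _ : ℤ => ℝ × UnitAddCircle) k).comp uniformContinuous_subtype_val

theorem exists_mid {c : ℝ} (hc : 0 < c) (hc' : c ≤ 1 / 2) (y : ℝ) :
    ∃ k : ℤ, 1 / 4 ≤ c * k - y ∧ c * k - y ≤ 3 / 4 := by
  refine ⟨⌈(y + 1 / 4) / c⌉, ?_, ?_⟩
  · have := Int.le_ceil ((y + 1 / 4) / c)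
    rw [div_le_iff₀ hc] at this
    linarith
  · have := (Int.ceil_lt_add_one ((y + 1 / 4) / c)).le
    have h2 := mul_le_mul_of_nonneg_left this hc.le
    rw [mul_add, mul_div_cancel₀ _ hc.ne'] at h2
    linarith

theorem line_inj (s : ℤ → ℕ) {c : ℝ} (hc : 0 < c) (hc' : c ≤ 1 / 2) :
    Function.Injective (line s c) := by
  intro r r' h
  obtain ⟨k, hk1, hk2⟩ := exists_mid hc hc' (-r)
  have h0 : line₀ s c r k = line₀ s c r' k := by
    have := congrArg Subtype.val h
    exact congrFun this k
  have h1 : hgt s (r + c * k) = hgt s (r' + c * k) := congrArg Prod.fst h0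
  have h2 : ((r + c * k : ℝ) : UnitAddCircle) = ((r' + c * k : ℝ) : UnitAddCircle) :=
    congrArg Prod.snd h0
  have h3 : hgt s (r + c * k) < 0 := (hgt_neg_iff s _).2 ⟨by linarith, by linarith⟩
  rw [h1, hgt_neg_iff] at h3
  obtain ⟨m, hm⟩ := circle_eq_int h2
  have hm1 : (-1 : ℝ) < m := by rw [← hm]; linarith [h3.2]
  have hm2 : (m : ℝ) < 1 := by rw [← hm]; linarith [h3.1]
  have hm1' : (-1 : ℤ) < m := by exact_mod_cast hm1
  have hm2' : m < (1 : ℤ) := by exact_mod_cast hm2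
  have : m = 0 := by omega
  rw [this] at hm
  push_cast at hm
  linarith

theorem line_open (s : ℤ → ℕ) {c : ℝ} (hc : 0 < c) (hc' : c ≤ 1 / 2) :
    IsOpenEmbedding (line s c) := by
  refine IsOpenEmbedding.of_continuous_injective_isOpenMap (line_uc s c).continuous
    (line_inj s hc hc') ?_
  intro U hU
  rw [isOpen_iff_mem_nhds]
  rintro _ ⟨r, hr, rfl⟩
  obtain ⟨k, hk1, hk2⟩ := exists_mid hc hc' (-r)
  have hWo : IsOpen {x : Sp s c | ((x : Amb) k).1 < 0} :=
    isOpen_lt (continuous_fst.comp (coord_uc s c k).continuous) continuous_const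
  have hCc : IsClosed (line s c '' Icc (-(c * k)) (1 - c * k)) :=
    (isCompact_Icc.image (line_uc s c).continuous).isClosed
  have hDc : IsClosed (line s c '' (Icc (-(c * k)) (1 - c * k) \ U)) :=
    ((isCompact_Icc.diff hU).image (line_uc s c).continuous).isClosed
  have hsub : {x : Sp s c | ((x : Amb) k).1 < 0} ⊆ line s c '' Icc (-(c * k)) (1 - c * k) := by
    have h1 := (line_dense s c).open_subset_closure_inter hWo
    refine h1.trans (closure_minimal ?_ hCc)
    rintro _ ⟨hx, r', rfl⟩
    have h3 : hgt s (r' + c * k) < 0 := hx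
    rw [hgt_neg_iff] at h3
    exact ⟨r', ⟨by linarith, by linarith⟩, rfl⟩
  have hmem : line s c r ∈ {x : Sp s c | ((x : Amb) k).1 < 0} ∩
      (line s c '' (Icc (-(c * k)) (1 - c * k) \ U))ᶜ := by
    refine ⟨?_, ?_⟩
    · have h3 : hgt s (r + c * k) < 0 := (hgt_neg_iff s _).2 ⟨by linarith, by linarith⟩
      exact h3
    · rintro ⟨r', hr', h⟩
      rw [line_inj s hc hc' h] at hr'
      exact hr'.2 hr
  filter_upwards [(hWo.inter hDc.isOpen_compl).mem_nhds hmem] with x hx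
  obtain ⟨y, hy, rfl⟩ := hsub hx.1
  refine ⟨y, ?_, rfl⟩
  by_contra hyU
  exact hx.2 ⟨y, ⟨hy, hyU⟩, rfl⟩

theorem shiftHomeo_env_zero (s : ℤ → ℕ) {c : ℝ} (hc : 0 < c) (hc' : c ≤ 1 / 2) :
    entropyOn (envMap (shiftHomeo s c)) (HSet (Sp s c)) = 0 := by
  refine env_zero (shiftHomeo s c) (line s c) c (fun x => ((x : Amb) 0).2)
    (continuous_snd.comp (coord_uc s c 0).continuous) (line_open s hc hc') (line_dense s c)
    (line_uc s c) (shiftHomeo_line s c) ?_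
  intro r
  simp [line, line₀]

/-! ### A sequence containing all words -/

theorem exists_universal : ∃ u : ℤ → ℕ, ∀ w : List ℕ, ∃ p : ℤ, 0 < p ∧
    ∀ i (hi : i < w.length), u (p + i) = w[i] := by
  refine ⟨fun k => (((Encodable.decode (α := List ℕ) (Nat.log 2 k.toNat).unpair.1).getD [])[
    k.toNat - 2 ^ (Nat.log 2 k.toNat)]?).getD 0, ?_⟩
  intro w
  set e := Nat.pair (Encodable.encode w) w.length with he
  refine ⟨((2 ^ e : ℕ) : ℤ), by positivity, ?_⟩
  intro i hi
  have hle : w.length ≤ e := Nat.right_le_pair _ _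
  have hlt : i < 2 ^ e := lt_of_lt_of_le hi (hle.trans Nat.lt_two_pow_self.le)
  have h1 : (((2 ^ e : ℕ) : ℤ) + (i : ℤ)).toNat = 2 ^ e + i := by
    omega
  have h2 : Nat.log 2 (2 ^ e + i) = e := by
    apply Nat.log_eq_of_pow_le_of_lt_pow (by omega)
    rw [pow_succ]
    omega
  simp only [h1, h2]
  rw [he, Nat.unpair_pair]
  simp [hi]

/-! ### Lower bound for the entropy -/

theorem letter_sep {M a b : ℕ} (ha : a < M) (hb : b < M) (hab : a ≠ b) :
    1 / (M : ℝ) ^ 2 ≤ |1 / ((a : ℝ) + 1) - 1 / ((b : ℝ) + 1)| := by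
  have ha' : (a : ℝ) + 1 ≤ M := by exact_mod_cast ha
  have hb' : (b : ℝ) + 1 ≤ M := by exact_mod_cast hb
  have ha0 : (0 : ℝ) < (a : ℝ) + 1 := by positivity
  have hb0 : (0 : ℝ) < (b : ℝ) + 1 := by positivity
  have h1 : 1 / ((a : ℝ) + 1) - 1 / ((b : ℝ) + 1)
      = ((b : ℝ) - a) / (((a : ℝ) + 1) * ((b : ℝ) + 1)) := by
    field_simp
    ring
  have h2 : (1 : ℝ) ≤ |(b : ℝ) - a| := by
    have : (1 : ℤ) ≤ |(b : ℤ) - a| := Int.one_le_abs (by omega)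
    exact_mod_cast this
  rw [h1, abs_div, abs_of_pos (mul_pos ha0 hb0)]
  apply div_le_div₀ (abs_nonneg _) h2 (mul_pos ha0 hb0)
  rw [pow_two]
  exact mul_le_mul ha' hb' hb0.le (by positivity)

theorem hgt_word (s : ℤ → ℕ) {p : ℤ} (hp : 0 < p) {y : ℝ} (i : ℕ) (h1 : 1 / 4 ≤ y - i)
    (h2 : y - i ≤ 3 / 4) : hgt s (p + y) = 1 / ((s (p + i) : ℝ) + 1) * saw (y - i) := by
  have hf : ⌊(p : ℝ) + y⌋ = p + i := by
    rw [Int.floor_eq_iff]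
    push_cast
    constructor <;> linarith
  have hne : p + (i : ℤ) ≠ 0 := by omega
  have hs : saw (p + y) = saw (y - i) := by
    have := saw_add_int (y - i) (p + i)
    rw [← this]
    congr 1
    push_cast
    ring
  unfold hgt letter
  rw [hf, if_neg hne, hs]

theorem entropy_lower (s : ℤ → ℕ) {c : ℝ} (hc : 0 < c) (hc' : c ≤ 1 / 2) {M : ℕ} (hM : 0 < M)
    (hw : ∀ w : List ℕ, (∀ a ∈ w, a < M) → ∃ p : ℤ, 0 < p ∧
      ∀ i (hi : i < w.length), s (p + i) = w[i]) :
    ((c * Real.log M : ℝ) : EReal) ≤ dynEntropy (shiftHomeo s c) := by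
  unfold dynEntropy
  refine le_trans ?_ (le_iSup₂ (f := fun (K : Set (Sp s c)) (_ : IsCompact K) =>
    entropyOnSet (shiftHomeo s c) K) univ isCompact_univ)
  have hM' : (0 : ℝ) < M := by exact_mod_cast hM
  obtain ⟨ε₀, hε₀, hε₀'⟩ := Metric.uniformContinuous_iff.1 (coord_uc s c 0)
    (1 / (M : ℝ) ^ 2 * (1 / 4)) (by positivity)
  have hε : 0 < ε₀ / 2 := by linarith
  unfold entropyOnSet
  refine le_trans ?_ (le_iSup₂ (f := fun (ε : ℝ) (_ : 0 < ε) => Filter.atTop.limsup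
    fun n : ℕ => ((Real.log (sepNum (shiftHomeo s c) n ε univ) / n : ℝ) : EReal)) (ε₀ / 2) hε)
  have key : ∀ n : ℕ, M ^ ⌊c * n⌋₊ ≤ sepNum (shiftHomeo s c) n (ε₀ / 2) univ := by
    intro n
    set N := ⌊c * n⌋₊ with hN
    have hNle : (N : ℝ) ≤ c * n := Nat.floor_le (by positivity)
    have hword : ∀ w : Fin N → Fin M, ∃ p : ℤ, 0 < p ∧ ∀ i : Fin N, s (p + (i : ℕ)) = w i := by
      intro w
      obtain ⟨p, hp, hp'⟩ := hw (List.ofFn fun i => (w i : ℕ)) (by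
        intro a ha
        rw [List.mem_ofFn] at ha
        obtain ⟨i, rfl⟩ := ha
        exact (w i).2)
      refine ⟨p, hp, fun i => ?_⟩
      rw [hp' i (by simp)]
      simp
    choose p hp hp' using hword
    have := le_sepNum_of (shiftHomeo s c) (shiftHomeo s c).continuous n hε
      (fun w => line s c (p w)) ?_
    · simpa using this
    · intro v w hvw
      obtain ⟨i, hi⟩ := Function.ne_iff.1 hvw
      obtain ⟨k, hk1, hk2⟩ := exists_mid hc hc' (i : ℕ)
      have hk0 : (0 : ℝ) < k := by
        have : 0 < c * k := by
          have : (0 : ℝ) ≤ ((i : ℕ) : ℝ) := Nat.cast_nonneg _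
          linarith
        exact (pos_iff_pos_of_mul_pos this).1 hc
      lift k to ℕ using (by exact_mod_cast hk0.le) with j
      simp only [Int.cast_natCast] at hk1 hk2
      have hi' : ((i : ℕ) : ℝ) + 1 ≤ N := by exact_mod_cast i.2
      have hjn : (j : ℝ) < n := by
        have : c * j < c * n := by linarith
        exact lt_of_mul_lt_mul_left this hc.le
      refine ⟨j, by exact_mod_cast hjn, ?_⟩
      rw [iterate_line _ _ c (shiftHomeo_line s c), iterate_line _ _ c (shiftHomeo_line s c)]
      by_contra hle
      push Not at hle
      have h1 := hε₀' (lt_of_le_of_lt hle (by linarith : ε₀ / 2 < ε₀))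
      have h2 : |hgt s (p v + c * j) - hgt s (p w + c * j)| < 1 / (M : ℝ) ^ 2 * (1 / 4) := by
        refine lt_of_le_of_lt ?_ h1
        rw [Prod.dist_eq]
        refine le_trans (le_of_eq ?_) (le_max_left _ _)
        simp [line, line₀, Real.dist_eq]
      rw [hgt_word s (hp v) i hk1 hk2, hgt_word s (hp w) i hk1 hk2, hp', hp', ← sub_mul,
        abs_mul, abs_of_nonneg (saw_nonneg _)] at h2
      have h3 := letter_sep (v i).2 (w i).2 (fun h => hi (Fin.ext h))
      have h4 := saw_ge hk1 hk2
      have h5 := mul_le_mul h3 h4 (by norm_num) (abs_nonneg _)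
      linarith
  have hlim : Tendsto (fun n : ℕ => (((⌊c * n⌋₊ : ℝ) * Real.log M / n : ℝ) : EReal)) atTop
      (𝓝 ((c * Real.log M : ℝ) : EReal)) := by
    refine (continuous_coe_real_ereal.tendsto _).comp ?_
    have h1 : Tendsto (fun n : ℕ => (⌊c * (n : ℝ)⌋₊ : ℝ) / (n : ℝ)) atTop (𝓝 c) :=
      (tendsto_nat_floor_mul_div_atTop hc.le).comp tendsto_natCast_atTop_atTop
    refine (h1.mul_const (Real.log M)).congr fun n => ?_
    ring
  rw [← hlim.limsup_eq]
  refine limsup_le_limsup (Eventually.of_forall fun n => ?_)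
  apply EReal.coe_le_coe_iff.2
  refine div_le_div_of_nonneg_right ?_ (Nat.cast_nonneg n)
  have := log_natCast_mono (key n)
  rwa [Nat.cast_pow, Real.log_pow] at this

/-! ### Upper bound for the entropy -/

theorem exists_window (s : ℤ → ℕ) (c : ℝ) {ε : ℝ} (hε : 0 < ε) :
    ∃ m : ℕ, ∃ η > 0, ∀ x y : Sp s c,
      (∀ k : ℤ, |k| ≤ m → dist ((x : Amb) k) ((y : Amb) k) < η) → dist x y < ε := by
  have hU : {p : Amb × Amb | dist p.1 p.2 < ε} ∈ uniformity Amb := Metric.dist_mem_uniformity hε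
  have hU' : {p : Amb × Amb | dist p.1 p.2 < ε} ∈
      ⨅ i : ℤ, (Filter.comap fun a : Amb × Amb => (a.1 i, a.2 i))
        (uniformity (ℝ × UnitAddCircle)) := by
    rw [← Pi.uniformity]
    exact hU
  obtain ⟨I, hI, V, hV, hVeq⟩ := Filter.mem_iInf.1 hU'
  have h1 : ∀ i : I, ∃ η > 0, ∀ p : Amb × Amb, dist (p.1 i) (p.2 i) < η → p ∈ V i := by
    intro i
    obtain ⟨W, hW, hWV⟩ := Filter.mem_comap.1 (hV i)
    obtain ⟨η, hη, hη'⟩ := Metric.mem_uniformity_dist.1 hW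
    exact ⟨η, hη, fun p hp => hWV (hη' hp)⟩
  choose g hg hg' using h1
  have : Finite I := hI
  have h2 : ∀ᶠ η in 𝓝[>] (0 : ℝ), ∀ i : I, η < g i := by
    rw [Filter.eventually_all]
    intro i
    exact (gt_mem_nhds (hg i)).filter_mono nhdsWithin_le_nhds
  obtain ⟨η, hη, hη0⟩ := (h2.and self_mem_nhdsWithin).exists
  have h3 : ∀ᶠ m : ℕ in atTop, ∀ i : I, |(i : ℤ)| ≤ m := by
    rw [Filter.eventually_all]
    intro i
    filter_upwards [eventually_ge_atTop (i : ℤ).natAbs] with m hm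
    rw [Int.abs_eq_natAbs]
    exact_mod_cast hm
  obtain ⟨m, hm⟩ := h3.exists
  refine ⟨m, η, hη0, fun x y hxy => ?_⟩
  have : ((x : Amb), (y : Amb)) ∈ {p : Amb × Amb | dist p.1 p.2 < ε} := by
    rw [hVeq, mem_iInter]
    intro i
    exact hg' i _ ((hxy i (hm i)).trans (hη i))
  exact this

theorem dyn_nhds {Z : Type*} [PseudoMetricSpace Z] (S : Z → Z) (hS : Continuous S) (n : ℕ)
    {ε : ℝ} (hε : 0 < ε) (x : Z) :
    ∀ᶠ y in 𝓝 x, ∀ j ∈ Finset.range n, dist (S^[j] x) (S^[j] y) < ε := by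
  have : ∀ j ∈ Finset.range n, ∀ᶠ y in 𝓝 x, dist (S^[j] x) (S^[j] y) < ε := by
    intro j _
    have hc : Continuous fun y => dist (S^[j] x) (S^[j] y) :=
      continuous_const.dist (hS.iterate j)
    have := hc.tendsto x
    simp only [dist_self] at this
    exact this.eventually (gt_mem_nhds hε)
  exact (Filter.eventually_all_finset _).2 this

theorem near_of_close (s : ℤ → ℕ) {r r' η : ℝ} (h : |r - r'| < η) (q : ℤ) :
    dist ((hgt s r, (r : UnitAddCircle)) : ℝ × UnitAddCircle)
      (hgt s r', ((r' - q : ℝ) : UnitAddCircle)) < η := by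
  rw [Prod.dist_eq]
  refine max_lt ((hgt_lip s r r').trans_lt h) ?_
  simp only [dist_circle]
  refine (round_le _ q).trans_lt ?_
  have : r - (r' - q) - q = r - r' := by ring
  rwa [this]

theorem near_of_word (s : ℤ → ℕ) {r r' η L : ℝ} (hL : 0 ≤ L) (R N : ℕ)
    (hN : N = ⌊L⌋₊ + 2 * R + 2)
    (hfr : |Int.fract r - Int.fract r'| < η)
    (hw : ∀ i : ℕ, i < N → letter s (⌊r⌋ - R + i) = letter s (⌊r'⌋ - R + i))
    {y : ℝ} (hy : -(R : ℝ) ≤ y) (hy' : y ≤ L + R) :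
    dist ((hgt s (r + y), ((r + y : ℝ) : UnitAddCircle)) : ℝ × UnitAddCircle)
      (hgt s (r' + y), ((r' + y : ℝ) : UnitAddCircle)) < η := by
  set q : ℤ := ⌊r⌋ - ⌊r'⌋ with hq
  have h1 : hgt s (r' + y) = hgt s (r' + y + q) := by
    unfold hgt
    rw [saw_add_int, Int.floor_add_intCast]
    congr 1
    have hlo : ⌊r'⌋ - (R : ℤ) ≤ ⌊r' + y⌋ := by
      rw [Int.le_floor]
      push_cast
      linarith [Int.floor_le r']
    have hhi : ⌊r' + y⌋ < ⌊r'⌋ + 1 + (⌊L⌋₊ + 1) + R := by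
      rw [Int.floor_lt]
      push_cast
      linarith [Int.lt_floor_add_one r', Nat.lt_floor_add_one L]
    obtain ⟨i, hi⟩ := Int.eq_ofNat_of_zero_le (by omega : 0 ≤ ⌊r' + y⌋ - (⌊r'⌋ - (R : ℤ)))
    have h2 := hw i (by omega)
    have e1 : ⌊r'⌋ - (R : ℤ) + i = ⌊r' + y⌋ := by omega
    have e2 : ⌊r⌋ - (R : ℤ) + i = ⌊r' + y⌋ + q := by omega
    rw [e1, e2] at h2
    exact h2.symm
  rw [h1]
  have h2 := near_of_close s (r := r + y) (r' := r' + y + q) (η := η) ?_ q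
  · have e : r' + y + q - (q : ℝ) = r' + y := by ring
    rwa [e] at h2
  · have : r + y - (r' + y + q) = Int.fract r - Int.fract r' := by
      rw [hq]
      unfold Int.fract
      push_cast
      ring
    rwa [this]

theorem abs_sub_lt_of_floor {a b η : ℝ} (hη : 0 < η) (ha : 0 ≤ a) (hb : 0 ≤ b)
    (h : ⌊a / η⌋₊ = ⌊b / η⌋₊) : |a - b| < η := by
  have a1 := Nat.floor_le (div_nonneg ha hη.le)
  have a2 := Nat.lt_floor_add_one (a / η)
  have b1 := Nat.floor_le (div_nonneg hb hη.le)
  have b2 := Nat.lt_floor_add_one (b / η)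
  rw [h] at a1 a2
  rw [le_div_iff₀ hη] at a1 b1
  rw [div_lt_iff₀ hη] at a2 b2
  rw [abs_lt]
  constructor <;> nlinarith

open Classical in
/-- The code of a point of the line. -/
noncomputable def codeR (s : ℤ → ℕ) (M : ℕ) (hs : ∀ k, s k < M) (η : ℝ) (R N : ℕ) (r : ℝ) :
    ℕ ⊕ ℕ × (Fin N → Fin M) :=
  if |r| ≤ N + 1 then Sum.inl ⌊(r + (N + 1)) / η⌋₊
  else Sum.inr (⌊Int.fract r / η⌋₊, fun i => ⟨s (⌊r⌋ - R + (i : ℕ)), hs _⟩)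

/-- The finite set of all codes. -/
def codeSet (η₁ η₂ N M : ℕ) : Finset (ℕ ⊕ ℕ × (Fin N → Fin M)) :=
  (Finset.range (η₁ + 1)).disjSum (Finset.range (η₂ + 1) ×ˢ Finset.univ)

theorem codeR_mem (s : ℤ → ℕ) (M : ℕ) (hs : ∀ k, s k < M) {η : ℝ} (hη : 0 < η) (R N : ℕ) (r : ℝ) :
    codeR s M hs η R N r ∈ codeSet ⌊2 * ((N : ℝ) + 1) / η⌋₊ ⌊1 / η⌋₊ N M := by
  unfold codeR codeSet
  split_ifs with h
  · rw [Finset.inl_mem_disjSum, Finset.mem_range, Nat.lt_succ_iff]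
    apply Nat.floor_mono
    have := (abs_le.1 h).2
    exact div_le_div_of_nonneg_right (by linarith) hη.le
  · rw [Finset.inr_mem_disjSum, Finset.mem_product, Finset.mem_range, Nat.lt_succ_iff]
    refine ⟨Nat.floor_mono ?_, Finset.mem_univ _⟩
    exact div_le_div_of_nonneg_right (Int.fract_lt_one r).le hη.le

theorem letter_far (s : ℤ → ℕ) (R N : ℕ) (hRN : R ≤ N) {r : ℝ} (h : ¬ |r| ≤ N + 1) (i : ℕ)
    (hi : i < N) : letter s (⌊r⌋ - R + i) = 1 / ((s (⌊r⌋ - R + i) : ℝ) + 1) := by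
  unfold letter
  rw [if_neg]
  intro h0
  apply h
  have h1 : ⌊r⌋ = (R : ℤ) - i := by omega
  have h2 := Int.floor_eq_iff.1 h1
  push_cast at h2
  have hi' : (i : ℝ) ≤ N := by exact_mod_cast hi.le
  have hR' : (R : ℝ) ≤ N := by exact_mod_cast hRN
  have hR0 : (0 : ℝ) ≤ R := Nat.cast_nonneg _
  have hi0 : (0 : ℝ) ≤ i := Nat.cast_nonneg _
  rw [abs_le]
  constructor <;> linarith [h2.1, h2.2]

theorem near_of_code (s : ℤ → ℕ) (M : ℕ) (hs : ∀ k, s k < M) {η : ℝ} (hη : 0 < η) {L : ℝ}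
    (hL : 0 ≤ L) (R N : ℕ) (hN : N = ⌊L⌋₊ + 2 * R + 2) {r r' : ℝ}
    (hcode : codeR s M hs η R N r = codeR s M hs η R N r')
    {y : ℝ} (hy : -(R : ℝ) ≤ y) (hy' : y ≤ L + R) :
    dist ((hgt s (r + y), ((r + y : ℝ) : UnitAddCircle)) : ℝ × UnitAddCircle)
      (hgt s (r' + y), ((r' + y : ℝ) : UnitAddCircle)) < η := by
  unfold codeR at hcode
  split_ifs at hcode with h1 h2 h2
  · have h3 := Sum.inl.inj hcode
    have h4 := abs_sub_lt_of_floor hη (by linarith [(abs_le.1 h1).1])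
      (by linarith [(abs_le.1 h2).1]) h3
    have h5 : |r + y - (r' + y)| < η := by
      have : r + y - (r' + y) = r + (N + 1) - (r' + (N + 1)) := by ring
      rwa [this]
    have h6 := near_of_close s h5 0
    simpa using h6
  · have h3 := Prod.mk.inj (Sum.inr.inj hcode)
    have h4 := abs_sub_lt_of_floor hη (Int.fract_nonneg r) (Int.fract_nonneg r') h3.1
    refine near_of_word s hL R N hN h4 ?_ hy hy'
    intro i hi
    have h5 := congrArg Fin.val (congrFun h3.2 ⟨i, hi⟩)
    simp only at h5
    rw [letter_far s R N (by omega) h1 i hi, letter_far s R N (by omega) h2 i hi, h5]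

theorem codeSet_card_le {η : ℝ} (hη : 0 < η) {N M : ℕ} (hM : 0 < M) :
    ((codeSet ⌊2 * ((N : ℝ) + 1) / η⌋₊ ⌊1 / η⌋₊ N M).card : ℝ) ≤
      (3 / η + 2) * ((N : ℝ) + 1) * (M : ℝ) ^ N := by
  unfold codeSet
  rw [Finset.card_disjSum, Finset.card_product, Finset.card_range, Finset.card_range,
    Finset.card_univ, Fintype.card_fun, Fintype.card_fin, Fintype.card_fin]
  push_cast
  have h1 := Nat.floor_le (by positivity : 0 ≤ 2 * ((N : ℝ) + 1) / η)
  have h2 := Nat.floor_le (by positivity : 0 ≤ 1 / η)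
  have hMN : (1 : ℝ) ≤ (M : ℝ) ^ N := one_le_pow₀ (by exact_mod_cast hM)
  have hN0 : (1 : ℝ) ≤ (N : ℝ) + 1 := by
    have : (0 : ℝ) ≤ N := Nat.cast_nonneg _
    linarith
  have hi : 0 < 1 / η := by positivity
  have e1 : 2 * ((N : ℝ) + 1) / η = 2 * (1 / η) * ((N : ℝ) + 1) := by ring
  have e2 : 3 / η = 3 * (1 / η) := by ring
  rw [e1] at h1
  rw [e1, e2]
  generalize 1 / η = z at *
  generalize (M : ℝ) ^ N = P at *
  generalize (N : ℝ) + 1 = Q at *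
  have a1 : 2 * z * Q + 1 ≤ (2 * z + 1) * Q := by linarith
  have a2 : (2 * z + 1) * Q ≤ (2 * z + 1) * Q * P := by
    apply le_mul_of_one_le_right _ hMN
    positivity
  have a3 : (z + 1) ≤ (z + 1) * Q := le_mul_of_one_le_right (by positivity) hN0
  have a4 : ((⌊z⌋₊ : ℝ) + 1) * P ≤ (z + 1) * Q * P := by
    apply mul_le_mul_of_nonneg_right _ (by positivity)
    linarith
  have a5 : (3 * z + 2) * Q * P = (2 * z + 1) * Q * P + (z + 1) * Q * P := by ring
  rw [a5]
  linarith

theorem sep_upper (s : ℤ → ℕ) {c : ℝ} (hc : 0 < c) {M : ℕ} (hs : ∀ k, s k < M) {ε : ℝ}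
    (hε : 0 < ε) (K : Set (Sp s c)) : ∃ D > 0, ∃ R : ℕ, ∀ n : ℕ,
      Real.log (sepNum (shiftHomeo s c) n ε K) ≤
        Real.log D + Real.log (((⌊c * n⌋₊ + 2 * R + 2 : ℕ) : ℝ) + 1) +
          ((⌊c * n⌋₊ + 2 * R + 2 : ℕ) : ℝ) * Real.log M := by
  have hM : 0 < M := lt_of_le_of_lt (Nat.zero_le _) (hs 0)
  obtain ⟨m, η, hη, hwin⟩ := exists_window s c (by linarith : 0 < ε / 3)
  refine ⟨3 / η + 2, by positivity, ⌈c * m⌉₊, fun n => ?_⟩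
  set R := ⌈c * m⌉₊ with hR
  have hRge : c * m ≤ R := Nat.le_ceil _
  set N := ⌊c * n⌋₊ + 2 * R + 2 with hN
  have happ : ∀ x : Sp s c, ∃ r : ℝ, ∀ j ∈ Finset.range n,
      dist ((shiftHomeo s c)^[j] x) ((shiftHomeo s c)^[j] (line s c r)) < ε / 3 := by
    intro x
    have h1 := dyn_nhds (shiftHomeo s c) (shiftHomeo s c).continuous n
      (by linarith : 0 < ε / 3) x
    obtain ⟨y, ⟨r, rfl⟩, hy⟩ := (line_dense s c).inter_nhds_nonempty h1
    exact ⟨r, hy⟩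
  choose ρ hρ using happ
  have hb : sepNum (shiftHomeo s c) n ε K ≤
      (codeSet ⌊2 * ((N : ℝ) + 1) / η⌋₊ ⌊1 / η⌋₊ N M).card := by
    refine sepNum_le_of _ n ε K (fun x => codeR s M hs η R N (ρ x)) _
      (fun x _ => codeR_mem s M hs hη R N (ρ x)) ?_
    intro x _ y _ hxy j hj
    have h1 := hρ x j (Finset.mem_range.2 hj)
    have h2 := hρ y j (Finset.mem_range.2 hj)
    have h3 : dist ((shiftHomeo s c)^[j] (line s c (ρ x)))
        ((shiftHomeo s c)^[j] (line s c (ρ y))) < ε / 3 := by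
      apply hwin
      intro k hk
      rw [iterate_line _ _ c (shiftHomeo_line s c), iterate_line _ _ c (shiftHomeo_line s c)]
      have hk' : |(k : ℝ)| ≤ m := by exact_mod_cast hk
      have hk1 := (abs_le.1 hk').1
      have hk2 := (abs_le.1 hk').2
      have hjn : (j : ℝ) ≤ n := by exact_mod_cast hj.le
      have hj0 : (0 : ℝ) ≤ j := Nat.cast_nonneg _
      have h4 := near_of_code s M hs hη (by positivity : 0 ≤ c * n) R N hN hxy
        (y := c * j + c * k) (by nlinarith) (by nlinarith)
      have e1 : ∀ z : ℝ, z + (c * j + c * k) = z + c * j + c * k := fun z => by ring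
      rw [e1, e1] at h4
      exact h4
    have h4 := dist_triangle4_right ((shiftHomeo s c)^[j] x) ((shiftHomeo s c)^[j] y)
      ((shiftHomeo s c)^[j] (line s c (ρ x))) ((shiftHomeo s c)^[j] (line s c (ρ y)))
    linarith
  refine (log_natCast_mono hb).trans ?_
  have hMr : (0 : ℝ) < M := by exact_mod_cast hM
  have hpos : 0 < ((codeSet ⌊2 * ((N : ℝ) + 1) / η⌋₊ ⌊1 / η⌋₊ N M).card : ℝ) := by
    have := Finset.card_pos.2 ⟨_, codeR_mem s M hs hη R N 0⟩
    exact_mod_cast this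
  refine (Real.log_le_log hpos (codeSet_card_le hη hM)).trans (le_of_eq ?_)
  have hN0 : (0 : ℝ) < (N : ℝ) + 1 := by positivity
  rw [Real.log_mul (by positivity) (by positivity), Real.log_mul (by positivity) (by positivity),
    Real.log_pow]

theorem entropy_upper (s : ℤ → ℕ) {c : ℝ} (hc : 0 < c) {M : ℕ} (hs : ∀ k, s k < M) :
    dynEntropy (shiftHomeo s c) ≤ ((c * Real.log M : ℝ) : EReal) := by
  unfold dynEntropy
  refine iSup_le fun K => iSup_le fun _ => ?_
  unfold entropyOnSet
  refine iSup_le fun ε => iSup_le fun hε => ?_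
  obtain ⟨D, hD, R, hb⟩ := sep_upper s hc hs hε K
  have hfl : Tendsto (fun n : ℕ => (⌊c * (n : ℝ)⌋₊ : ℝ) / (n : ℝ)) atTop (𝓝 c) :=
    (tendsto_nat_floor_mul_div_atTop hc.le).comp tendsto_natCast_atTop_atTop
  have hcst : ∀ z : ℝ, Tendsto (fun n : ℕ => z / (n : ℝ)) atTop (𝓝 0) := fun z =>
    tendsto_const_nhds.div_atTop tendsto_natCast_atTop_atTop
  have hNn : ∀ z : ℝ, Tendsto (fun n : ℕ => ((⌊c * (n : ℝ)⌋₊ : ℝ) + z) / (n : ℝ)) atTop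
      (𝓝 c) := by
    intro z
    have := hfl.add (hcst z)
    rw [add_zero] at this
    exact this.congr fun n => by ring
  have hNtop : Tendsto (fun n : ℕ => (⌊c * (n : ℝ)⌋₊ : ℝ) + (2 * R + 3)) atTop atTop := by
    apply tendsto_atTop_add_const_right
    refine tendsto_natCast_atTop_atTop.comp (tendsto_nat_floor_atTop.comp ?_)
    exact tendsto_natCast_atTop_atTop.const_mul_atTop hc
  have hlogx : Tendsto (fun x : ℝ => Real.log x / x) atTop (𝓝 0) :=
    Real.isLittleO_log_id_atTop.tendsto_div_nhds_zero
  have hlogN := (hlogx.comp hNtop).mul (hNn (2 * R + 3))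
  rw [zero_mul] at hlogN
  have hsum := ((hcst (Real.log D)).add hlogN).add ((hNn (2 * R + 2)).mul_const (Real.log M))
  rw [zero_add, zero_add] at hsum
  have hlim := (continuous_coe_real_ereal.tendsto _).comp hsum
  rw [← hlim.limsup_eq]
  refine limsup_le_limsup (Eventually.of_forall fun n => ?_)
  apply EReal.coe_le_coe_iff.2
  refine (div_le_div_of_nonneg_right (hb n) (Nat.cast_nonneg n)).trans (le_of_eq ?_)
  have hpos : (⌊c * (n : ℝ)⌋₊ : ℝ) + (2 * R + 3) ≠ 0 := by positivity
  have e : (((⌊c * n⌋₊ + 2 * R + 2 : ℕ) : ℝ) + 1) = (⌊c * (n : ℝ)⌋₊ : ℝ) + (2 * R + 3) := by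
    push_cast
    ring
  simp only [Function.comp_apply]
  rw [e, add_div, add_div, div_mul_div_cancel₀ hpos]
  push_cast
  ring

/-- For every `t ∈ (0, ∞]` there is a homeomorphism `T` of a compact metric space with
topological entropy `t` whose functional envelope on the group of homeomorphisms has entropy
zero. -/
theorem exists_positive_entropy_with_zero_envelope (t : EReal) (ht : 0 < t) :
    ∃ (X : Type) (_ : MetricSpace X) (_ : CompactSpace X),
      ∃ T : X ≃ₜ X, dynEntropy ⇑T = t ∧ entropyOn (envMap T) (HSet X) = 0 := by
  obtain ⟨u, hu⟩ := exists_universal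
  induction t with
  | bot => exact absurd ht (by simp)
  | top =>
    refine ⟨Sp u (1 / 2), inferInstance, inferInstance, shiftHomeo u (1 / 2), ?_,
      shiftHomeo_env_zero u (by norm_num) le_rfl⟩
    have h1 : ∀ M : ℕ, 0 < M → (((1 / 2 : ℝ) * Real.log M : ℝ) : EReal) ≤
        dynEntropy (shiftHomeo u (1 / 2)) := fun M hM =>
      entropy_lower u (by norm_num) le_rfl hM fun w _ => hu w
    rw [EReal.eq_top_iff_forall_lt]
    intro y
    obtain ⟨M, hM⟩ := exists_nat_gt (Real.exp (2 * y))
    have hM0 : (0 : ℝ) < M := (Real.exp_pos _).trans hM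
    refine lt_of_lt_of_le ?_ (h1 M (by exact_mod_cast hM0))
    apply EReal.coe_lt_coe_iff.2
    have := (Real.lt_log_iff_exp_lt hM0).2 hM
    linarith
  | coe τ =>
    have hτ : 0 < τ := by exact_mod_cast ht
    obtain ⟨M, hM⟩ := exists_nat_gt (Real.exp (2 * τ))
    have hM0 : (0 : ℝ) < M := (Real.exp_pos _).trans hM
    have hMn : 0 < M := by exact_mod_cast hM0
    have hlog := (Real.lt_log_iff_exp_lt hM0).2 hM
    have hlog0 : 0 < Real.log M := by linarith
    have hc : 0 < τ / Real.log M := by positivity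
    have hc' : τ / Real.log M ≤ 1 / 2 := by
      rw [div_le_iff₀ hlog0]
      linarith
    have hcl : τ / Real.log M * Real.log M = τ := div_mul_cancel₀ _ hlog0.ne'
    refine ⟨Sp (fun k => u k % M) (τ / Real.log M), inferInstance, inferInstance,
      shiftHomeo _ _, le_antisymm ?_ ?_, shiftHomeo_env_zero _ hc hc'⟩
    · have := entropy_upper (fun k => u k % M) hc (M := M) fun k => Nat.mod_lt _ hMn
      rwa [hcl] at this
    · have := entropy_lower (fun k => u k % M) hc hc' hMn ?_
      · rwa [hcl] at this
      · intro w hw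
        obtain ⟨p, hp, hp'⟩ := hu w
        refine ⟨p, hp, fun i hi => ?_⟩
        rw [hp' i hi, Nat.mod_eq_of_lt (hw _ (List.getElem_mem hi))]
end

section
/- There exists a non-degenerate continuum X which is not homeomorphic to the circle, which admits a minimal homeomorphism, and which admits no minimal non-invertible continuous self-map; that is, every minimal continuous map T : X → X is a homeomorphism. -/
open Set Filter Topology

/-- A self-map of a topological space is minimal if every forward orbit is dense. -/
def IsMinimal {X : Type*} [TopologicalSpace X] (T : X → X) : Prop :=
  ∀ x : X, Dense (Set.range fun n : ℕ => T^[n] x)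

namespace Slovak

/-- The circle `ℝ / ℤ`. -/
abbrev Circ : Type := AddCircle (1 : ℝ)

/-- The ambient countable product of circles; the dyadic solenoid lives in it. -/
abbrev G : Type := ℕ → Circ

/-- The one-parameter group through `0` in the solenoid. -/
noncomputable def φ (t : ℝ) : G := fun i => ((t / 2 ^ i : ℝ) : Circ)

theorem φ_add (s t : ℝ) : φ (s + t) = φ s + φ t := by
  funext i; simp [φ, add_div]

theorem φ_sub (s t : ℝ) : φ (s - t) = φ s - φ t := by
  funext i; simp [φ, sub_div]

theorem φ_zero : φ 0 = 0 := by
  funext i; simp [φ]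

theorem φ_continuous : Continuous φ := by
  refine continuous_pi fun i => ?_
  exact (AddCircle.continuous_mk' (1:ℝ)).comp (continuous_id.div_const _)

theorem norm_coe_of_le {t : ℝ} (h : |t| ≤ 1 / 2) : ‖((t : ℝ) : Circ)‖ = |t| := by
  rw [AddCircle.norm_coe_eq_abs_iff 1 one_ne_zero]; simpa using h

theorem norm_coe_le (t : ℝ) : ‖((t : ℝ) : Circ)‖ ≤ |t| := by
  by_cases h : |t| ≤ 1 / 2
  · exact (norm_coe_of_le h).le
  · have := AddCircle.norm_le_half_period (1:ℝ) (x := (t : Circ)) one_ne_zero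
    simp at this
    push Not at h
    linarith

theorem norm_circ_le (x : Circ) : ‖x‖ ≤ 1 := by
  have := AddCircle.norm_le_half_period (1:ℝ) (x := x) one_ne_zero
  simp at this
  linarith

theorem φ_eq_zero {t : ℝ} (h : φ t = 0) : t = 0 := by
  obtain ⟨i, hi⟩ := pow_unbounded_of_one_lt (2 * |t|) (one_lt_two (α := ℝ))
  have h1 : ‖((t / 2 ^ i : ℝ) : Circ)‖ = 0 := by
    have := congrFun h i
    simp only [φ] at this
    rw [this]; simp
  have h2 : |t / 2 ^ i| ≤ 1 / 2 := by
    rw [abs_div, abs_of_pos (by positivity : (0:ℝ) < 2 ^ i), div_le_iff₀ (by positivity)]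
    linarith
  rw [norm_coe_of_le h2] at h1
  have := abs_eq_zero.1 h1
  rcases div_eq_zero_iff.1 this with h | h
  · exact h
  · exact absurd h (by positivity)

theorem φ_inj {s t : ℝ} (h : φ s = φ t) : s = t := by
  have : φ (s - t) = 0 := by rw [φ_sub, h, sub_self]
  linarith [φ_eq_zero this]

/-- A gauge measuring the distance to `0`. -/
noncomputable def d (x : G) : ℝ := ∑' i, (1 / 2 : ℝ) ^ i * ‖x i‖

theorem d_summable (x : G) : Summable fun i => (1 / 2 : ℝ) ^ i * ‖x i‖ := by
  refine Summable.of_nonneg_of_le (fun i => by positivity) (fun i => ?_) summable_geometric_two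
  exact mul_le_of_le_one_right (by positivity) (norm_circ_le _)

theorem d_continuous : Continuous d := by
  refine continuous_tsum (u := fun i => (1 / 2 : ℝ) ^ i) (fun i => ?_) summable_geometric_two
    fun i x => ?_
  · exact continuous_const.mul (continuous_apply i).norm
  · rw [Real.norm_of_nonneg (by positivity)]
    exact mul_le_of_le_one_right (by positivity) (norm_circ_le _)

theorem d_eq_zero {x : G} (h : d x = 0) : x = 0 := by
  have := (hasSum_zero_iff_of_nonneg (f := fun i => (1 / 2 : ℝ) ^ i * ‖x i‖)
    (fun i => by positivity)).1 (by rw [← h]; exact (d_summable x).hasSum)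
  funext i
  have := congrFun this i
  simpa using this

theorem d_nonneg (x : G) : 0 ≤ d x := tsum_nonneg fun i => by positivity

theorem d_φ_le (t : ℝ) : d (φ t) ≤ 2 * |t| := by
  have h : HasSum (fun i : ℕ => (1 / 2 : ℝ) ^ i * |t|) (2 * |t|) :=
    hasSum_geometric_two.mul_right _
  refine hasSum_le (fun i => ?_) (d_summable (φ t)).hasSum h
  refine mul_le_mul_of_nonneg_left ?_ (by positivity)
  refine (norm_coe_le _).trans ?_
  rw [abs_div, abs_of_pos (by positivity : (0:ℝ) < 2 ^ i)]
  exact div_le_self (abs_nonneg _) (one_le_pow₀ one_le_two)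

/-- A nonnegative function vanishing on the right of `0` but not on the left. -/
noncomputable def w (x : G) : ℝ := max 0 (‖x 0 - ((1 / 4 : ℝ) : Circ)‖ - 1 / 4)

theorem w_continuous : Continuous w := by
  unfold w
  fun_prop

theorem w_φ_right {t : ℝ} (h0 : 0 ≤ t) (h1 : t ≤ 1 / 2) : w (φ t) = 0 := by
  have : ‖φ t 0 - ((1 / 4 : ℝ) : Circ)‖ ≤ |t - 1 / 4| := by
    have := norm_coe_le (t - 1 / 4)
    simpa [φ] using this
  have h2 : |t - 1 / 4| ≤ 1 / 4 := by rw [abs_le]; constructor <;> linarith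
  exact max_eq_left (by linarith)

theorem w_φ_left {r : ℝ} (h0 : 0 ≤ r) (h1 : r ≤ 1 / 4) : w (φ (-r)) = r := by
  have h2 : |-r - 1 / 4| = r + 1 / 4 := by
    rw [abs_of_nonpos (by linarith)]; ring
  have : ‖φ (-r) 0 - ((1 / 4 : ℝ) : Circ)‖ = |-r - 1 / 4| := by
    have := norm_coe_of_le (t := -r - 1 / 4) (by rw [h2]; linarith)
    rw [← this]
    simp [φ]
  unfold w
  rw [this, h2, max_eq_right (by linarith)]; ring

/-- The singular function: continuous off `0`, one-sided oscillation along the leaf of `0`. -/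
noncomputable def g (x : G) : ℝ := Real.cos (w x / d x ^ 2)

theorem g_mem (x : G) : g x ∈ Icc (-1 : ℝ) 1 := Real.cos_mem_Icc _

theorem g_continuousAt {x : G} (h : x ≠ 0) : ContinuousAt g x := by
  have hd : d x ^ 2 ≠ 0 := pow_ne_zero _ fun h' => h (d_eq_zero h')
  exact Real.continuous_cos.continuousAt.comp
    (w_continuous.continuousAt.div (d_continuous.continuousAt.pow 2) hd)

theorem g_φ_right {t : ℝ} (h0 : 0 ≤ t) (h1 : t ≤ 1 / 2) : g (φ t) = 1 := by
  simp [g, w_φ_right h0 h1]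

theorem g_φ_continuousOn : ContinuousOn (fun t => g (φ t)) (Ici 0) := by
  intro t ht
  rcases eq_or_lt_of_le (show (0:ℝ) ≤ t from ht) with h | h
  · subst h
    have : (fun t => g (φ t)) =ᶠ[𝓝[Ici 0] 0] fun _ => 1 := by
      have h1 : Iio (1 / 2 : ℝ) ∈ 𝓝[Ici 0] (0:ℝ) :=
        mem_nhdsWithin_of_mem_nhds (Iio_mem_nhds (by norm_num))
      filter_upwards [self_mem_nhdsWithin, h1] with s hs hs1
      exact g_φ_right hs (le_of_lt hs1)
    refine (continuousWithinAt_const (b := (1:ℝ))).congr_of_eventuallyEq this ?_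
    exact g_φ_right le_rfl (by norm_num)
  · have h0 : φ t ≠ 0 := fun h' => h.ne' (φ_eq_zero h')
    exact (ContinuousAt.comp (f := φ) (g := g) (g_continuousAt h0)
      φ_continuous.continuousAt).continuousWithinAt

theorem g_osc {η a : ℝ} (hη : 0 < η) (ha : a ∈ Icc (-1 : ℝ) 1) :
    ∃ r, 0 < r ∧ r < η ∧ g (φ (-r)) = a := by
  set r0 : ℝ := min η (1 / 4) / 2 with hr0
  have hm : 0 < min η (1 / 4) := lt_min hη (by norm_num)
  have hr0p : 0 < r0 := by positivity
  have hr0η : r0 < η := by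
    have := min_le_left η (1 / 4); linarith
  have hr04 : r0 ≤ 1 / 4 := by
    have := min_le_right η (1 / 4); linarith
  set θ : ℝ → ℝ := fun r => w (φ (-r)) / d (φ (-r)) ^ 2 with hθ
  have hdpos : ∀ r, 0 < r → 0 < d (φ (-r)) := fun r hr =>
    lt_of_le_of_ne (d_nonneg _) fun h => by
      have := φ_eq_zero (d_eq_zero h.symm); linarith
  have hcont : ∀ r1, 0 < r1 → ContinuousOn θ (Icc r1 r0) := by
    intro r1 h1
    have hneg : Continuous fun r : ℝ => φ (-r) := φ_continuous.comp continuous_neg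
    refine ContinuousOn.div (w_continuous.comp hneg).continuousOn
      ((d_continuous.comp hneg).pow 2).continuousOn fun r hr => ?_
    exact pow_ne_zero _ (hdpos r (lt_of_lt_of_le h1 hr.1)).ne'
  have hlow : ∀ r, 0 < r → r ≤ 1 / 4 → 1 / (4 * r) ≤ θ r := by
    intro r hr hr4
    have h1 : d (φ (-r)) ≤ 2 * r := by simpa [abs_of_pos hr] using d_φ_le (-r)
    have h2 : d (φ (-r)) ^ 2 ≤ (2 * r) ^ 2 := pow_le_pow_left₀ (d_nonneg _) h1 2
    have h3 := hdpos r hr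
    simp only [hθ, w_φ_left hr.le hr4]
    rw [div_le_div_iff₀ (by positivity) (by positivity)]
    nlinarith
  obtain ⟨k, hk⟩ := exists_nat_ge (θ r0)
  set A : ℝ := Real.arccos a + k * (2 * Real.pi) with hA
  have hpi := Real.pi_gt_three
  have hAc : 0 ≤ Real.arccos a := Real.arccos_nonneg a
  have hθ0 : 0 < θ r0 := lt_of_lt_of_le (by positivity) (hlow r0 hr0p hr04)
  have hAk : θ r0 ≤ A := by
    have : (k:ℝ) ≤ k * (2 * Real.pi) := by
      have : (0:ℝ) ≤ k := Nat.cast_nonneg k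
      nlinarith
    linarith
  have hA0 : 0 < A := lt_of_lt_of_le hθ0 hAk
  set r1 : ℝ := min r0 (1 / (4 * A)) with hr1
  have hr1p : 0 < r1 := lt_min hr0p (by positivity)
  have hr10 : r1 ≤ r0 := min_le_left _ _
  have hθ1 : A ≤ θ r1 := by
    refine le_trans ?_ (hlow r1 hr1p (hr10.trans hr04))
    have : r1 ≤ 1 / (4 * A) := min_le_right _ _
    rw [le_div_iff₀ (by positivity)] at this ⊢
    linarith
  obtain ⟨r, hr, hrA⟩ := intermediate_value_Icc' hr10 (hcont r1 hr1p) ⟨hAk, hθ1⟩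
  refine ⟨r, lt_of_lt_of_le hr1p hr.1, lt_of_le_of_lt hr.2 hr0η, ?_⟩
  change Real.cos (θ r) = a
  rw [hrA, hA, Real.cos_add_nat_mul_two_pi, Real.cos_arccos ha.1 ha.2]

/-- The step of the rotation along the leaf. -/
noncomputable def τ : ℝ := √2

theorem τ_gt : 1 < τ := by
  unfold τ
  exact Real.lt_sqrt_of_sq_lt (by norm_num)

/-- Points of the solenoid. -/
def IsSol (x : G) : Prop := ∀ i, x (i + 1) + x (i + 1) = x i

theorem isSol_φ (t : ℝ) : IsSol (φ t) := by
  intro i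
  simp only [φ]
  rw [← AddCircle.coe_add]
  congr 1
  rw [pow_succ]; field_simp; ring

theorem IsSol.add {x y : G} (hx : IsSol x) (hy : IsSol y) : IsSol (x + y) := by
  intro i
  simp only [Pi.add_apply]
  rw [← hx i, ← hy i]; abel

theorem isClosed_sol : IsClosed {x : G | IsSol x} := by
  simp only [IsSol, ofPred_forall]
  exact isClosed_iInter fun i => isClosed_eq (by fun_prop) (by fun_prop)

theorem IsSol.nsmul {x : G} (hx : IsSol x) (i k : ℕ) : x i = (2 ^ k : ℕ) • x (i + k) := by
  induction k with
  | zero => simp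
  | succ k ih =>
    rw [ih, ← hx (i + k), pow_succ, mul_smul, two_smul, add_assoc]

theorem dense_aux {y y' : G} (hy : IsSol y) (hy' : IsSol y') {U : Set G} (hU : IsOpen U)
    (hyU : y' ∈ U) : ∃ n : ℤ, y + φ (n * τ) ∈ U := by
  obtain ⟨I, u, hu, hIU⟩ := isOpen_pi_iff.1 hU y' hyU
  obtain ⟨N, hN⟩ : ∃ N, ∀ i ∈ I, i ≤ N := ⟨I.sup id, fun i hi => Finset.le_sup (f := id) hi⟩
  set V : Set Circ := ⋂ i ∈ I, (fun a : Circ => (2 ^ (N - i) : ℕ) • a) ⁻¹' (u i) with hV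
  have hVo : IsOpen V := isOpen_biInter_finset fun i hi =>
    (hu i hi).1.preimage (continuous_nsmul _)
  have key : ∀ x : G, IsSol x → x N ∈ V → x ∈ U := by
    intro x hx hxV
    refine hIU fun i hi => ?_
    have h1 := mem_iInter₂.1 hxV i hi
    have h2 := hx.nsmul i (N - i)
    rw [Nat.add_sub_cancel' (hN i hi)] at h2
    rw [h2]; exact h1
  have hV' : y' N ∈ V := by
    refine mem_iInter₂.2 fun i hi => ?_
    have h2 := hy'.nsmul i (N - i)
    rw [Nat.add_sub_cancel' (hN i hi)] at h2
    change (2 ^ (N - i) : ℕ) • y' N ∈ u i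
    rw [← h2]; exact (hu i hi).2
  have hirr : Irrational ((τ / 2 ^ N) / 1) := by
    have := irrational_sqrt_two.div_natCast (m := 2 ^ N) (by positivity)
    simpa [τ] using this
  have hd := AddCircle.denseRange_zsmul_coe_iff.2 hirr
  have hne : ((fun a => y N + a) ⁻¹' V).Nonempty := ⟨y' N - y N, by simpa using hV'⟩
  obtain ⟨n, hn⟩ := hd.exists_mem_open (hVo.preimage (continuous_const.add continuous_id)) hne
  refine ⟨n, key _ (hy.add (isSol_φ _)) ?_⟩
  have : φ (n * τ) N = n • ((τ / 2 ^ N : ℝ) : Circ) := by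
    simp only [φ]
    rw [← AddCircle.coe_zsmul]
    congr 1
    simp [mul_div_assoc]
  rw [Pi.add_apply, this]
  exact hn

end Slovak

namespace Slovak

/-- The special points on the leaf of `0`. -/
noncomputable def z (n : ℤ) : G := φ (n * τ)

theorem z_inj {m n : ℤ} (h : z m = z n) : m = n := by
  have h1 := φ_inj h
  have h2 : τ ≠ 0 := by linarith [τ_gt]
  exact_mod_cast mul_right_cancel₀ h2 h1

theorem z_add (m n : ℤ) : z (m + n) = z m + z n := by
  unfold z; rw [← φ_add]; congr 1; push_cast; ring

theorem z_zero : z 0 = 0 := by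
  simp [z, φ_zero]

/-- The continuum, as a subset of a product. -/
def XS : Set (G × (ℤ → ℝ)) :=
  {p | IsSol p.1 ∧ ∀ n, p.2 n ∈ Icc (-1 : ℝ) 1 ∧ (p.1 ≠ z n → p.2 n = g (p.1 - z n))}

theorem isClosed_XS : IsClosed XS := by
  have h : XS = (Prod.fst ⁻¹' {x : G | IsSol x}) ∩ ⋂ n : ℤ,
      ({p : G × (ℤ → ℝ) | p.2 n ∈ Icc (-1 : ℝ) 1} ∩
        {p : G × (ℤ → ℝ) | p.1 ≠ z n → p.2 n = g (p.1 - z n)}) := by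
    ext p
    simp [XS]
  rw [h]
  refine (isClosed_sol.preimage continuous_fst).inter (isClosed_iInter fun n => ?_)
  refine IsClosed.inter (isClosed_Icc.preimage (f := fun p : G × (ℤ → ℝ) => p.2 n)
    (by fun_prop)) ?_
  rw [← isOpen_compl_iff, isOpen_iff_mem_nhds]
  intro p hp
  have hp' : p.1 ≠ z n ∧ p.2 n ≠ g (p.1 - z n) := by
    simpa using hp
  have hc : ContinuousAt (fun p : G × (ℤ → ℝ) => g (p.1 - z n)) p :=
    ContinuousAt.comp (f := fun p : G × (ℤ → ℝ) => p.1 - z n) (g := g)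
      (g_continuousAt (sub_ne_zero.2 hp'.1)) (by fun_prop)
  have hc2 : ContinuousAt (fun p : G × (ℤ → ℝ) => p.2 n) p := by fun_prop
  have hc1 : ContinuousAt (fun p : G × (ℤ → ℝ) => p.1) p := by fun_prop
  filter_upwards [hc1.eventually_ne hp'.1, (hc2.sub hc).eventually_ne (sub_ne_zero.2 hp'.2)]
    with q h1 h2
  simp only [mem_compl_iff, mem_ofPred_eq, Classical.not_imp]
  exact ⟨h1, sub_ne_zero.1 h2⟩

theorem isCompact_XS : IsCompact XS := by
  have h : IsCompact ((univ : Set G) ×ˢ (Set.pi univ fun _ : ℤ => Icc (-1 : ℝ) 1)) :=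
    isCompact_univ.prod (isCompact_univ_pi fun _ => isCompact_Icc)
  refine h.of_isClosed_subset isClosed_XS fun p hp => ?_
  exact ⟨mem_univ _, fun n _ => (hp.2 n).1⟩

/-- The continuum. -/
abbrev X : Type := XS

instance instCompactX : CompactSpace X := isCompact_iff_compactSpace.1 isCompact_XS

/-- The canonical (discontinuous) section. -/
noncomputable def sec (y : G) : G × (ℤ → ℝ) := (y, fun n => g (y - z n))

theorem sec_mem {y : G} (hy : IsSol y) : sec y ∈ XS :=
  ⟨hy, fun _ => ⟨g_mem _, fun _ => rfl⟩⟩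

theorem eq_sec {p : G × (ℤ → ℝ)} (hp : p ∈ XS) (h : ∀ n, p.1 ≠ z n) : p = sec p.1 := by
  refine Prod.ext rfl (funext fun n => (hp.2 n).2 (h n))

theorem shift_mem (k : ℤ) {p : G × (ℤ → ℝ)} (hp : p ∈ XS) :
    ((p.1 + z k, fun n => p.2 (n - k)) : G × (ℤ → ℝ)) ∈ XS := by
  refine ⟨hp.1.add (isSol_φ _), fun n => ⟨(hp.2 _).1, fun h => ?_⟩⟩
  have h1 : z n = z (n - k) + z k := by rw [← z_add]; simp
  simp only at h ⊢
  rw [h1] at h ⊢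
  rw [(hp.2 (n - k)).2 fun h' => h (by rw [h'])]
  congr 1; abel

/-- The shift maps. -/
noncomputable def sh (k : ℤ) (x : X) : X := ⟨(x.1.1 + z k, fun n => x.1.2 (n - k)), shift_mem k x.2⟩

theorem sh_sh (k l : ℤ) (x : X) : sh k (sh l x) = sh (l + k) x := by
  refine Subtype.ext (Prod.ext ?_ (funext fun n => ?_))
  · simp [sh, z_add, add_assoc]
  · simp only [sh]; rw [sub_sub, add_comm k l]

theorem sh_zero (x : X) : sh 0 x = x := by
  refine Subtype.ext (Prod.ext ?_ (funext fun n => ?_))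
  · simp [sh, z_zero]
  · simp [sh]

theorem sh_continuous (k : ℤ) : Continuous (sh k) := by
  unfold sh
  refine Continuous.subtype_mk (Continuous.prodMk (by fun_prop) (continuous_pi fun n => ?_)) _
  exact (continuous_apply (n - k)).comp (continuous_snd.comp continuous_subtype_val)

/-- The shift homeomorphisms. -/
noncomputable def shH (k : ℤ) : X ≃ₜ X where
  toFun := sh k
  invFun := sh (-k)
  left_inv x := by rw [sh_sh, add_neg_cancel, sh_zero]
  right_inv x := by rw [sh_sh, neg_add_cancel, sh_zero]
  continuous_toFun := sh_continuous k
  continuous_invFun := sh_continuous (-k)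

/-- Special arcs lie in the closure of the piece of leaf to their left. -/
theorem exists_seq (n : ℤ) {p : G × (ℤ → ℝ)} (hp : p ∈ XS) (hn : p.1 = z n) :
    ∃ t : ℕ → ℝ, (∀ j, (n - 1) * τ < t j ∧ t j < n * τ) ∧
      Tendsto (fun j => sec (φ (t j))) atTop (𝓝 p) := by
  have h1 : ∀ j : ℕ, ∃ r : ℝ, 0 < r ∧ r < 1 / ((j : ℝ) + 1) ∧ g (φ (-r)) = p.2 n := fun j =>
    g_osc (by positivity) (hp.2 n).1
  choose r hr0 hr1 hr2 using h1
  have hlim : Tendsto r atTop (𝓝 0) :=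
    squeeze_zero (fun j => (hr0 j).le) (fun j => (hr1 j).le) tendsto_one_div_add_atTop_nhds_zero_nat
  refine ⟨fun j => n * τ - r j, fun j => ⟨?_, by linarith [hr0 j]⟩, ?_⟩
  · have h2 : 1 / ((j : ℝ) + 1) ≤ 1 := by
      rw [div_le_one (by positivity)]
      have : (0:ℝ) ≤ j := Nat.cast_nonneg j
      linarith
    have := τ_gt
    have := hr1 j
    nlinarith
  · have hφ : Tendsto (fun j => φ (n * τ - r j)) atTop (𝓝 (z n)) := by
      have h3 : Tendsto (fun j => n * τ - r j) atTop (𝓝 (n * τ - 0)) := hlim.const_sub _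
      rw [sub_zero] at h3
      exact (φ_continuous.tendsto _).comp h3
    refine Prod.tendsto_iff _ _ |>.2 ⟨by rw [hn]; exact hφ, tendsto_pi_nhds.2 fun m => ?_⟩
    by_cases hm : m = n
    · subst hm
      have : ∀ j, (sec (φ (m * τ - r j))).2 m = p.2 m := by
        intro j
        simp only [sec, z]
        rw [← φ_sub, ← hr2 j]
        congr 2; ring
      simp only [this]
      exact tendsto_const_nhds
    · have hne : z n ≠ z m := fun h => hm (z_inj h).symm
      have h4 := (hp.2 m).2 (by rw [hn]; exact hne)
      rw [h4, hn]
      exact (g_continuousAt (sub_ne_zero.2 hne)).tendsto.comp (hφ.sub_const _)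

theorem ne_z_of_between {n : ℤ} {t : ℝ} (h1 : (n - 1) * τ < t) (h2 : t < n * τ) (m : ℤ) :
    φ t ≠ z m := by
  intro h
  have h3 := φ_inj h
  have h4 := τ_gt
  subst h3
  have h5 : ((n:ℝ) - 1) < m := lt_of_mul_lt_mul_right h1 (by linarith)
  have h6 : (m:ℝ) < n := lt_of_mul_lt_mul_right h2 (by linarith)
  have h7 : n - 1 < m := by exact_mod_cast h5
  have h8 : m < n := by exact_mod_cast h6
  omega

theorem minimal_two_sided {M : Set X} (hM : IsClosed M) (hne : M.Nonempty)
    (hinv : ∀ k, ∀ x ∈ M, sh k x ∈ M) : M = univ := by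
  have hcl : IsClosed ((fun x : X => x.1.1) '' M) :=
    (hM.isCompact.image (by fun_prop)).isClosed
  have step1 : ∀ y, IsSol y → ∃ x ∈ M, x.1.1 = y := by
    intro y hy
    by_contra hcon
    obtain ⟨x0, hx0⟩ := hne
    obtain ⟨n, hn⟩ := dense_aux x0.2.1 hy hcl.isOpen_compl hcon
    exact hn ⟨sh n x0, hinv n x0 hx0, rfl⟩
  have step2 : ∀ x : X, (∀ n, x.1.1 ≠ z n) → x ∈ M := by
    intro x hx
    obtain ⟨x', h1, h2⟩ := step1 x.1.1 x.2.1
    have : x = x' := Subtype.ext (by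
      rw [eq_sec x.2 hx, eq_sec x'.2 (by rw [h2]; exact hx), h2])
    rw [this]; exact h1
  refine eq_univ_of_forall fun x => ?_
  by_cases hx : ∀ n, x.1.1 ≠ z n
  · exact step2 x hx
  · push Not at hx
    obtain ⟨n, hn⟩ := hx
    obtain ⟨t, ht, hlim⟩ := exists_seq n x.2 hn
    have hlim' : Tendsto (fun j => (⟨sec (φ (t j)), sec_mem (isSol_φ _)⟩ : X)) atTop (𝓝 x) :=
      tendsto_subtype_rng.2 hlim
    refine hM.mem_of_tendsto hlim' (Eventually.of_forall fun j => step2 _ ?_)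
    exact ne_z_of_between (ht j).1 (ht j).2

theorem minimal_one_sided {M : Set X} (hM : IsClosed M) (hne : M.Nonempty) {e : ℤ}
    (he : e = 1 ∨ e = -1) (hinv : ∀ x ∈ M, sh e x ∈ M) : M = univ := by
  set F : ℕ → Set X := fun n => sh (-(e * n)) ⁻¹' M with hF
  have hFc : ∀ n, IsClosed (F n) := fun n => hM.preimage (sh_continuous _)
  have hN : (⋂ n, F n).Nonempty := by
    refine IsCompact.nonempty_iInter_of_sequence_nonempty_isCompact_isClosed F (fun n => ?_)
      (fun n => ?_) (hFc 0).isCompact hFc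
    · intro x hx
      have := hinv _ hx
      rw [sh_sh] at this
      simp only [hF, mem_preimage]
      convert this using 2
      push_cast; ring
    · obtain ⟨x, hx⟩ := hne
      refine ⟨sh (e * n) x, ?_⟩
      simp only [hF, mem_preimage, sh_sh, add_neg_cancel, sh_zero]
      exact hx
  have hsub : (⋂ n, F n) ⊆ M := by
    intro x hx
    have := mem_iInter.1 hx 0
    simpa [hF, sh_zero] using this
  have hp : ∀ x ∈ ⋂ n, F n, sh e x ∈ ⋂ n, F n := by
    intro x hx
    refine mem_iInter.2 fun n => ?_
    rcases n with _ | n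
    · simpa [hF, sh_zero] using hinv x (hsub hx)
    · have := mem_iInter.1 hx n
      simp only [hF, mem_preimage, sh_sh] at this ⊢
      convert this using 2
      push_cast; ring
  have hm : ∀ x ∈ ⋂ n, F n, sh (-e) x ∈ ⋂ n, F n := by
    intro x hx
    refine mem_iInter.2 fun n => ?_
    have := mem_iInter.1 hx (n + 1)
    simp only [hF, mem_preimage, sh_sh] at this ⊢
    convert this using 2
    push_cast; ring
  have hpm : (∀ x ∈ ⋂ n, F n, sh 1 x ∈ ⋂ n, F n) ∧ (∀ x ∈ ⋂ n, F n, sh (-1) x ∈ ⋂ n, F n) := by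
    rcases he with rfl | rfl
    · exact ⟨hp, hm⟩
    · exact ⟨by simpa using hm, hp⟩
  have hall : ∀ k, ∀ x ∈ ⋂ n, F n, sh k x ∈ ⋂ n, F n := by
    intro k
    induction k using Int.induction_on with
    | zero => intro x hx; rwa [sh_zero]
    | succ k ih =>
      intro x hx
      have := hpm.1 _ (ih x hx)
      rwa [sh_sh] at this
    | pred k ih =>
      intro x hx
      have := hpm.2 _ (ih x hx)
      rwa [sh_sh] at this
  have := minimal_two_sided (isClosed_iInter hFc) hN hall
  exact univ_subset_iff.1 (this ▸ hsub)

theorem sh_iterate (n : ℕ) (x : X) : (sh 1)^[n] x = sh n x := by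
  induction n with
  | zero => simp [sh_zero]
  | succ n ih => rw [Function.iterate_succ_apply', ih, sh_sh]; push_cast; rfl

theorem sh_isMinimal : IsMinimal (sh 1) := by
  intro x
  rw [dense_iff_closure_eq]
  refine minimal_one_sided (e := 1) isClosed_closure ⟨x, subset_closure ⟨0, rfl⟩⟩ (Or.inl rfl) ?_
  intro y hy
  refine map_mem_closure (sh_continuous 1) hy ?_
  rintro _ ⟨n, rfl⟩
  exact ⟨n + 1, Function.iterate_succ_apply' _ _ _⟩

theorem dense_tail_pos (x : X) (N : ℤ) : Dense {y | ∃ n, N ≤ n ∧ y = sh n x} := by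
  rw [dense_iff_closure_eq]
  refine minimal_one_sided (e := 1) isClosed_closure ⟨sh N x, subset_closure ⟨N, le_rfl, rfl⟩⟩
    (Or.inl rfl) ?_
  intro y hy
  refine map_mem_closure (sh_continuous 1) hy ?_
  rintro _ ⟨n, hn, rfl⟩
  exact ⟨n + 1, by omega, by rw [sh_sh]⟩

theorem dense_tail_neg (x : X) (N : ℤ) : Dense {y | ∃ n, n ≤ N ∧ y = sh n x} := by
  rw [dense_iff_closure_eq]
  refine minimal_one_sided (e := -1) isClosed_closure ⟨sh N x, subset_closure ⟨N, le_rfl, rfl⟩⟩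
    (Or.inr rfl) ?_
  intro y hy
  refine map_mem_closure (sh_continuous (-1)) hy ?_
  rintro _ ⟨n, hn, rfl⟩
  exact ⟨n + -1, by omega, by rw [sh_sh]⟩

end Slovak

namespace Slovak

/-- The pieces of the special leaf. -/
def L (n : ℤ) : Set X := {x | ∃ t : ℝ, n * τ ≤ t ∧ t < (n + 1) * τ ∧ x.1.1 = φ t}

/-- The special arcs. -/
def A (n : ℤ) : Set X := {x | x.1.1 = z n}

theorem A_subset_L (n : ℤ) : A n ⊆ L n := fun x hx =>
  ⟨n * τ, le_rfl, by nlinarith [τ_gt], hx⟩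

theorem L_disj {m n : ℤ} {x : X} (hm : x ∈ L m) (hn : x ∈ L n) : m = n := by
  obtain ⟨s, hs1, hs2, hs⟩ := hm
  obtain ⟨t, ht1, ht2, ht⟩ := hn
  obtain rfl : s = t := φ_inj (hs.symm.trans ht)
  have hτ : 0 ≤ τ := by linarith [τ_gt]
  have h1 : (m:ℝ) < n + 1 := lt_of_mul_lt_mul_right (lt_of_le_of_lt hs1 ht2) hτ
  have h2 : (n:ℝ) < m + 1 := lt_of_mul_lt_mul_right (lt_of_le_of_lt ht1 hs2) hτ
  have h3 : m < n + 1 := by exact_mod_cast h1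
  have h4 : n < m + 1 := by exact_mod_cast h2
  omega

theorem closure_L (n : ℤ) : closure (L n) ⊆ L n ∪ A (n + 1) := by
  have hcl : IsClosed ((fun x : X => x.1.1) ⁻¹' (φ '' Icc (n * τ) ((n + 1) * τ))) :=
    ((isCompact_Icc.image φ_continuous).isClosed).preimage (by fun_prop)
  have hsub : L n ⊆ (fun x : X => x.1.1) ⁻¹' (φ '' Icc (n * τ) ((n + 1) * τ)) := by
    rintro x ⟨t, h1, h2, h3⟩
    exact ⟨t, ⟨h1, h2.le⟩, h3.symm⟩
  intro x hx
  obtain ⟨t, ⟨h1, h2⟩, h3⟩ := closure_minimal hsub hcl hx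
  rcases h2.lt_or_eq with h | h
  · exact Or.inl ⟨t, h1, h, h3.symm⟩
  · refine Or.inr ?_
    change x.1.1 = z (n + 1)
    have h4 : x.1.1 = φ t := h3.symm
    rw [h4, h, z]; push_cast; rfl

theorem A_subset_closure (n : ℤ) : A (n + 1) ⊆ closure (L n) := by
  intro x hx
  obtain ⟨t, ht, hlim⟩ := exists_seq (n + 1) x.2 hx
  have hlim' : Tendsto (fun j => (⟨sec (φ (t j)), sec_mem (isSol_φ _)⟩ : X)) atTop (𝓝 x) :=
    tendsto_subtype_rng.2 hlim
  refine mem_closure_of_tendsto hlim' (Eventually.of_forall fun j => ⟨t j, ?_, ?_, rfl⟩)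
  · have := (ht j).1; push_cast at this; linarith
  · have := (ht j).2; push_cast at this; linarith

theorem joined_of_continuousOn {f : ℝ → G × (ℤ → ℝ)} {s : Set ℝ} (hs : Convex ℝ s)
    (hf : ContinuousOn f s) (hX : ∀ t ∈ s, f t ∈ XS) {a b : ℝ} (ha : a ∈ s) (hb : b ∈ s) :
    Joined (⟨f a, hX a ha⟩ : X) ⟨f b, hX b hb⟩ := by
  have h1 : IsPathConnected (f '' s) := (hs.isPathConnected ⟨a, ha⟩).image' hf
  have h2 : JoinedIn (f '' s) (f a) (f b) := h1.joinedIn _ ⟨a, ha, rfl⟩ _ ⟨b, hb, rfl⟩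
  have h3 : JoinedIn XS (f a) (f b) := h2.mono (by rintro _ ⟨t, ht, rfl⟩; exact hX t ht)
  exact (joinedIn_iff_joined _ _).1 h3

/-- The base point of the special arc `A n`. -/
noncomputable def e (n : ℤ) : X := ⟨sec (z n), sec_mem (isSol_φ _)⟩

theorem e_mem (n : ℤ) : e n ∈ A n := rfl

theorem joined_A {n : ℤ} {x : X} (hx : x ∈ A n) : Joined x (e n) := by
  have hx' : x.1.1 = z n := hx
  set f : ℝ → G × (ℤ → ℝ) := fun s => (z n, Function.update x.1.2 n s) with hf
  have hfX : ∀ s ∈ Icc (-1 : ℝ) 1, f s ∈ XS := by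
    intro s hs
    refine ⟨isSol_φ _, fun m => ?_⟩
    by_cases hm : m = n
    · subst hm; simpa [hf] using hs
    · have := x.2.2 m
      rw [hx'] at this
      simpa [hf, Function.update_of_ne hm] using this
  have hfc : Continuous f := continuous_const.prodMk (continuous_const.update n continuous_id)
  have := joined_of_continuousOn (convex_Icc (-1:ℝ) 1) hfc.continuousOn hfX
    (x.2.2 n).1 (show (1:ℝ) ∈ Icc (-1:ℝ) 1 by norm_num)
  convert this using 1
  · refine Subtype.ext (Prod.ext hx' ?_)
    simp [hf]
  · refine Subtype.ext (Prod.ext rfl (funext fun m => ?_))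
    by_cases hm : m = n
    · subst hm
      have := g_φ_right (t := 0) le_rfl (by norm_num)
      rw [φ_zero] at this
      simp [hf, e, sec, this]
    · have := (x.2.2 m).2 (by rw [hx']; exact fun h => hm (z_inj h).symm)
      simp [hf, e, sec, Function.update_of_ne hm, this, hx']

theorem sec_φ_continuousOn (n : ℤ) :
    ContinuousOn (fun t => sec (φ t)) (Ico (n * τ) ((n + 1) * τ)) := by
  refine φ_continuous.continuousOn.prodMk (continuousOn_pi.2 fun m => ?_)
  have h0 : ∀ t, φ t - z m = φ (t - m * τ) := fun t => by rw [φ_sub]; rfl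
  simp only [h0]
  by_cases hm : m ≤ n
  · refine g_φ_continuousOn.comp (f := fun t => t - m * τ) (by fun_prop) fun t ht => ?_
    have : (m:ℝ) ≤ n := by exact_mod_cast hm
    have := τ_gt
    have := ht.1
    simp only [mem_Ici]
    nlinarith
  · intro t ht
    have hne : φ (t - m * τ) ≠ 0 := by
      intro h
      have h1 := φ_eq_zero h
      have h2 := ht.2
      have h3 : (n:ℝ) + 1 ≤ m := by
        have : n + 1 ≤ m := by omega
        exact_mod_cast this
      have := τ_gt
      nlinarith
    refine ContinuousAt.continuousWithinAt ?_
    exact ContinuousAt.comp (f := fun t => φ (t - m * τ)) (g := g) (g_continuousAt hne)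
      (φ_continuous.comp (by fun_prop)).continuousAt

theorem joined_e {n : ℤ} {x : X} (hx : x ∈ L n) : Joined x (e n) := by
  obtain ⟨t, h1, h2, h3⟩ := hx
  rcases h1.eq_or_lt with h | h
  · refine joined_A ?_
    change x.1.1 = z n
    rw [h3, ← h]; rfl
  · have hτ := τ_gt
    have := joined_of_continuousOn (convex_Ico _ _) (sec_φ_continuousOn n)
      (fun t _ => sec_mem (isSol_φ t)) (a := t) (b := n * τ) ⟨h1, h2⟩ ⟨le_rfl, by linarith⟩
    change Joined _ (e n) at this
    convert this using 1
    refine Subtype.ext ?_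
    change x.1 = sec (φ t)
    rw [← h3]
    refine eq_sec x.2 ?_
    rw [h3]
    exact ne_z_of_between (n := n + 1) (by push_cast; linarith) (by push_cast; linarith)

theorem joined_L {n : ℤ} {x y : X} (hx : x ∈ L n) (hy : y ∈ L n) : Joined x y :=
  (joined_e hx).trans (joined_e hy).symm

/-- Lifting a path of the continuum starting over the special leaf. -/
theorem exists_lift (γ : C(unitInterval, X)) (t0 : ℝ) (h0 : (γ 0).1.1 = φ t0) :
    ∃ c : C(unitInterval, ℝ), c 0 = t0 ∧ ∀ s, (γ s).1.1 = φ (c s) := by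
  have cov := AddCircle.isCoveringMap_coe (1:ℝ)
  have hl : ∀ i : ℕ, ∃ c : C(unitInterval, ℝ), c 0 = t0 / 2 ^ i ∧
      ∀ s, (γ s).1.1 i = ((c s : ℝ) : Circ) := by
    intro i
    let p : C(unitInterval, Circ) := ⟨fun s => (γ s).1.1 i, by fun_prop⟩
    have hp : p 0 = ((t0 / 2 ^ i : ℝ) : Circ) := by
      change (γ 0).1.1 i = _
      rw [h0]; rfl
    obtain ⟨c, hc, hc0⟩ := cov.exists_path_lifts p _ hp
    exact ⟨c, hc0, fun s => (congrFun hc s).symm⟩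
  choose c hc0 hc using hl
  refine ⟨c 0, by simpa using hc0 0, fun s => funext fun i => ?_⟩
  have hi : ∀ i : ℕ, ∀ s, c i s = c 0 s / 2 ^ i := by
    intro i
    induction i with
    | zero => simp
    | succ i ih =>
      have h1 : (fun s => 2 * c (i + 1) s) = fun s => c i s := by
        refine cov.eq_of_comp_eq (by fun_prop) (by fun_prop) (funext fun s => ?_) 0 ?_
        · have := (γ s).2.1 i
          rw [hc (i + 1), hc i, ← AddCircle.coe_add, ← two_mul] at this
          exact this
        · rw [hc0, hc0, pow_succ]; field_simp
      intro s
      have := congrFun h1 s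
      rw [ih s] at this
      rw [pow_succ]
      field_simp at this ⊢
      linarith
  rw [hc i s, hi i s]; rfl

/-- No path crosses a special point from the left. -/
theorem no_cross {c v : ℝ → ℝ} (hc : Continuous c) (hv : Continuous v) {a : ℝ}
    (hcv : ∀ s, c s ≠ a → v s = g (φ (c s - a))) (h0 : c 0 < a) {s1 : ℝ} (hs1 : 0 ≤ s1) :
    c s1 < a := by
  by_contra hcon
  push Not at hcon
  have hK : IsCompact (Icc 0 s1 ∩ c ⁻¹' (Ici a)) :=
    isCompact_Icc.inter_right (isClosed_Ici.preimage hc)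
  obtain ⟨s, ⟨⟨hs0, hs1'⟩, hsa⟩, hmin⟩ := hK.exists_isLeast ⟨s1, ⟨hs1, le_rfl⟩, hcon⟩
  have hlt : ∀ u, 0 ≤ u → u < s → c u < a := by
    intro u hu hus
    by_contra hcu
    push Not at hcu
    exact absurd (hmin ⟨⟨hu, by linarith⟩, hcu⟩) (by linarith)
  have hs : 0 < s := by
    rcases hs0.lt_or_eq with h | h
    · exact h
    · subst h
      exact absurd h0 (not_lt.2 hsa)
  obtain ⟨δ, hδ, hball⟩ := Metric.continuousAt_iff.1 (hv.continuousAt (x := s)) 1 one_pos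
  set u0 : ℝ := max 0 (s - δ / 2) with hu0
  have hu0s : u0 < s := max_lt hs (by linarith)
  have hu00 : 0 ≤ u0 := le_max_left _ _
  have hu0δ : s - δ / 2 ≤ u0 := le_max_right _ _
  have hval : ∀ b ∈ Icc (-1:ℝ) 1, |b - v s| < 1 := by
    intro b hb
    obtain ⟨r, hr0, hr1, hr⟩ := g_osc (sub_pos.2 (hlt u0 hu00 hu0s)) hb
    obtain ⟨u, hu, hcu⟩ := intermediate_value_Icc hu0s.le hc.continuousOn
      (show a - r ∈ Icc (c u0) (c s) from ⟨by linarith, by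
        have : a ≤ c s := hsa
        linarith⟩)
    have h1 : v u = b := by
      rw [hcv u (by rw [hcu]; linarith), hcu, ← hr]
      congr 2; ring
    have h2 : dist u s < δ := by
      rw [Real.dist_eq, abs_lt]
      constructor <;> linarith [hu.1, hu.2]
    have := hball h2
    rwa [h1, Real.dist_eq] at this
  have h1 := abs_lt.1 (hval 1 (by norm_num))
  have h2 := abs_lt.1 (hval (-1) (by norm_num))
  linarith [h1.2, h2.1]

theorem L_of_joined {n : ℤ} {x y : X} (hx : x ∈ L n) (h : Joined x y) : y ∈ L n := by
  obtain ⟨γ⟩ := h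
  obtain ⟨t0, h1, h2, h3⟩ := hx
  obtain ⟨c, hc0, hc⟩ := exists_lift γ.toContinuousMap t0 (by simpa using h3)
  set pr : ℝ → unitInterval := projIcc 0 1 zero_le_one with hpr
  have hprc : Continuous pr := continuous_projIcc
  have hp0 : pr 0 = 0 := projIcc_left _
  have hp1 : pr 1 = 1 := projIcc_right _
  have hv : ∀ m : ℤ, Continuous fun s => (γ (pr s)).1.2 m := fun m => by fun_prop
  have hcc : Continuous fun s => c (pr s) := by fun_prop
  have hcv : ∀ m : ℤ, ∀ s, c (pr s) ≠ m * τ →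
      (γ (pr s)).1.2 m = g (φ (c (pr s) - m * τ)) := by
    intro m s hs
    have hz : (γ (pr s)).1.1 = φ (c (pr s)) := hc (pr s)
    have := ((γ (pr s)).2.2 m).2 (by rw [hz]; exact fun h => hs (φ_inj h))
    rw [this, hz, φ_sub]; rfl
  have up : c 1 < (n + 1) * τ := by
    have := no_cross hcc (hv (n + 1)) (hcv (n + 1)) (by rw [hp0, hc0]; push_cast; exact h2)
      zero_le_one
    rw [hp1] at this; push_cast at this; exact this
  have down : n * τ ≤ c 1 := by
    by_contra hlt
    push Not at hlt
    have := no_cross (c := fun s => c (pr (1 - s))) (v := fun s => (γ (pr (1 - s))).1.2 n)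
      (hcc.comp (by fun_prop)) ((hv n).comp (by fun_prop)) (a := n * τ)
      (fun s => hcv n (1 - s)) (by simpa [hp1] using hlt) zero_le_one
    simp only [sub_self, hp0, hc0] at this
    linarith
  refine ⟨c 1, down, up, ?_⟩
  have := hc 1
  simpa using this

theorem dense_of_regular {x : X} (hx : ∀ n, x ∉ L n) : Dense {y | Joined x y} := by
  have hreg : ∀ t : ℝ, x.1.1 ≠ φ t := by
    intro t ht
    have hτ : 0 < τ := by linarith [τ_gt]
    refine hx ⌊t / τ⌋ ⟨t, ?_, ?_, ht⟩
    · exact (le_div_iff₀ hτ).1 (Int.floor_le _)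
    · exact (div_lt_iff₀ hτ).1 (Int.lt_floor_add_one _)
  have hsol : ∀ t, IsSol (x.1.1 + φ t) := fun t => x.2.1.add (isSol_φ t)
  have hcont : Continuous fun t => sec (x.1.1 + φ t) := by
    have h1 : Continuous fun t => x.1.1 + φ t := continuous_const.add φ_continuous
    refine h1.prodMk (continuous_pi fun m => continuous_iff_continuousAt.2 fun t => ?_)
    refine ContinuousAt.comp (f := fun t => x.1.1 + φ t - z m) (g := g) (g_continuousAt ?_)
      (h1.sub continuous_const).continuousAt
    intro h
    refine hreg (m * τ - t) ?_
    rw [φ_sub, eq_sub_iff_add_eq]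
    exact sub_eq_zero.1 h
  have hx0 : x = ⟨sec (x.1.1 + φ 0), sec_mem (hsol 0)⟩ := by
    refine Subtype.ext ?_
    change x.1 = sec (x.1.1 + φ 0)
    rw [φ_zero, add_zero]
    exact eq_sec x.2 fun n => hreg _
  refine (dense_tail_pos x 0).mono ?_
  rintro _ ⟨n, -, rfl⟩
  have := joined_of_continuousOn convex_univ hcont.continuousOn
    (fun t _ => sec_mem (hsol t)) (mem_univ 0) (mem_univ (n * τ))
  rw [← hx0] at this
  change Joined x (sh n x)
  convert this using 1
  refine Subtype.ext ?_
  refine (eq_sec (sh n x).2 fun m => ?_)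
  intro h
  refine hreg (m * τ - n * τ) ?_
  rw [φ_sub, eq_sub_iff_add_eq]
  exact h

theorem sh_e (n k : ℤ) : (sh k (e n)) ∈ A (n + k) := by
  change z n + z k = z (n + k)
  rw [z_add]

instance instConnX : ConnectedSpace X := by
  have hL : ∀ n, IsConnected (closure (L n)) := by
    intro n
    have : IsPathConnected (L n) := by
      refine ⟨e n, A_subset_L n (e_mem n), fun {y} hy => ?_⟩
      obtain ⟨γ⟩ := (joined_e hy).symm
      refine ⟨γ, fun t => ?_⟩
      exact L_of_joined (A_subset_L n (e_mem n)) ⟨(γ.truncateOfLE t.2.1).cast (by simp) (by simp)⟩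
    exact this.isConnected.closure
  have hU : IsConnected (⋃ n, closure (L n)) := by
    refine IsConnected.iUnion_of_chain hL fun n => ?_
    rw [show Order.succ n = n + 1 from rfl]
    exact ⟨e (n + 1), A_subset_closure n (e_mem _), subset_closure (A_subset_L _ (e_mem _))⟩
  have hD : closure (⋃ n, closure (L n)) = univ := by
    refine dense_iff_closure_eq.1 ((dense_tail_pos (e 0) 0).mono ?_)
    rintro _ ⟨n, -, rfl⟩
    exact mem_iUnion.2 ⟨0 + n, subset_closure (A_subset_L _ (sh_e 0 n))⟩
  have := hU.closure
  rw [hD] at this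
  exact connectedSpace_iff_univ.2 this

/-- The combinatorial part of the rigidity argument. -/
theorem comb {R : ℤ → ℤ → Prop} (hex : ∀ m, ∃ n, R n m)
    (hun : ∀ n m m', R n m → R n m' → m = m')
    (hst : ∀ n m, R n m → R (n + 1) m ∨ R (n + 1) (m + 1)) (hne : ∀ n, ¬ R n n) :
    ∃ k N : ℤ, (∀ n, N ≤ n → R n (n + k)) ∨ (∀ n, n ≤ N → R n (n + k)) := by
  have fwd : ∀ n m, R n m → ∀ j : ℕ, ∃ m', m ≤ m' ∧ m' ≤ m + j ∧ R (n + j) m' := by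
    intro n m h j
    induction j with
    | zero => exact ⟨m, le_rfl, by simp, by simpa using h⟩
    | succ j ih =>
      obtain ⟨m', h1, h2, h3⟩ := ih
      rcases hst _ _ h3 with h4 | h4
      · exact ⟨m', h1, by push_cast; omega, by push_cast; rwa [← add_assoc]⟩
      · exact ⟨m' + 1, by omega, by push_cast; omega, by push_cast; rwa [← add_assoc]⟩
  have fwd' : ∀ n m n' m', R n m → R n' m' → n ≤ n' → m ≤ m' ∧ m' ≤ m + (n' - n) := by
    intro n m n' m' h h' hle
    obtain ⟨j, hj⟩ := Int.eq_ofNat_of_zero_le (sub_nonneg.2 hle)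
    obtain ⟨m'', h1, h2, h3⟩ := fwd n m h j
    have : n + (j : ℤ) = n' := by omega
    rw [this] at h3
    have := hun _ _ _ h' h3
    omega
  have tot : ∀ n, ∃ m, R n m := by
    intro n
    obtain ⟨n0, hn0⟩ := hex 0
    obtain ⟨n1, hn1⟩ := hex (-(|n0 - n| + 1))
    have habs := le_abs_self (n0 - n)
    have habs0 := abs_nonneg (n0 - n)
    have hle : n1 ≤ n := by
      by_contra hlt
      push Not at hlt
      rcases le_total n0 n1 with h | h
      · have := fwd' _ _ _ _ hn0 hn1 h
        omega
      · have := fwd' _ _ _ _ hn1 hn0 h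
        omega
    obtain ⟨j, hj⟩ := Int.eq_ofNat_of_zero_le (sub_nonneg.2 hle)
    obtain ⟨m'', h1, h2, h3⟩ := fwd _ _ hn1 j
    have : n1 + (j : ℤ) = n := by omega
    rw [this] at h3
    exact ⟨m'', h3⟩
  choose σ hσ using tot
  have hmono : ∀ n n', n ≤ n' → σ n' - n' ≤ σ n - n := fun n n' h => by
    have := fwd' _ _ _ _ (hσ n) (hσ n') h
    omega
  have hstep : ∀ n, σ (n + 1) = σ n ∨ σ (n + 1) = σ n + 1 := fun n => by
    have := fwd' _ _ _ _ (hσ n) (hσ (n + 1)) (by omega)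
    omega
  have h0 : ∀ n, σ n ≠ n := fun n h => hne n (by have := hσ n; rwa [h] at this)
  rcases lt_or_gt_of_ne (h0 0) with h | h
  · have hneg : ∀ j : ℕ, σ (-(j:ℤ)) - (-(j:ℤ)) < 0 := by
      intro j
      induction j with
      | zero => simpa using h
      | succ j ih =>
        have h1 := hstep (-((j + 1 : ℕ) : ℤ))
        have h2 := h0 (-((j + 1 : ℕ) : ℤ))
        have h3 : -((j + 1 : ℕ) : ℤ) + 1 = -(j : ℤ) := by push_cast; ring
        rw [h3] at h1
        push_cast at *
        omega
    obtain ⟨J, hJ⟩ : ∃ J : ℕ, ∀ j : ℕ, (-(σ (-(J:ℤ)) - (-(J:ℤ)))).toNat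
        ≤ (-(σ (-(j:ℤ)) - (-(j:ℤ)))).toNat := by
      obtain ⟨J, hJ⟩ := exists_minimalFor_of_wellFoundedLT (fun _ : ℕ => True)
        (fun j : ℕ => (-(σ (-(j:ℤ)) - (-(j:ℤ)))).toNat) ⟨0, trivial⟩
      exact ⟨J, fun j => by
        by_contra hcon
        exact hcon (hJ.2 trivial (le_of_not_ge hcon))⟩
    refine ⟨σ (-(J:ℤ)) - (-(J:ℤ)), -(J:ℤ), Or.inr fun n hn => ?_⟩
    obtain ⟨j, hj⟩ := Int.eq_ofNat_of_zero_le (show 0 ≤ -n by omega)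
    obtain rfl : n = -(j:ℤ) := by omega
    have h1 := hJ j
    have h2 := hneg j
    have h3 := hneg J
    have h4 := hmono _ _ hn
    have h5 : -(j:ℤ) + (σ (-(J:ℤ)) - (-(J:ℤ))) = σ (-(j:ℤ)) := by omega
    rw [h5]; exact hσ _
  · have hpos : ∀ j : ℕ, 0 < σ (j:ℤ) - (j:ℤ) := by
      intro j
      induction j with
      | zero => simpa using h
      | succ j ih =>
        have h1 := hstep (j : ℤ)
        have h2 := h0 ((j:ℤ) + 1)
        push_cast
        omega
    obtain ⟨J, hJ⟩ : ∃ J : ℕ, ∀ j : ℕ, (σ (J:ℤ) - (J:ℤ)).toNat ≤ (σ (j:ℤ) - (j:ℤ)).toNat := by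
      obtain ⟨J, hJ⟩ := exists_minimalFor_of_wellFoundedLT (fun _ : ℕ => True)
        (fun j : ℕ => (σ (j:ℤ) - (j:ℤ)).toNat) ⟨0, trivial⟩
      exact ⟨J, fun j => by
        by_contra hcon
        exact hcon (hJ.2 trivial (le_of_not_ge hcon))⟩
    refine ⟨σ (J:ℤ) - (J:ℤ), (J:ℤ), Or.inl fun n hn => ?_⟩
    obtain ⟨j, hj⟩ := Int.eq_ofNat_of_zero_le (show 0 ≤ n by omega)
    obtain rfl : n = (j:ℤ) := by omega
    have h1 := hJ j
    have h2 := hpos j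
    have h3 := hpos J
    have h4 := hmono _ _ hn
    have h5 : (j:ℤ) + (σ (J:ℤ) - (J:ℤ)) = σ (j:ℤ) := by omega
    rw [h5]; exact hσ _

theorem surjective_of_minimal {S : X → X} (hS : Continuous S) (hmin : IsMinimal S) :
    Function.Surjective S := by
  have hcl : IsClosed (range S) := (isCompact_range hS).isClosed
  have hd : Dense (range S) := by
    refine (hmin (S (e 0))).mono ?_
    rintro _ ⟨n, rfl⟩
    refine ⟨S^[n] (e 0), ?_⟩
    rw [← Function.iterate_succ_apply' S, Function.iterate_succ_apply]
  exact range_eq_univ.1 (hcl.closure_eq ▸ hd.closure_eq)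

theorem L_not_dense (n : ℤ) : ¬ Dense (L n) := by
  intro h
  have h1 : e (n + 2) ∈ closure (L n) := h _
  have h2 := A_subset_L _ (e_mem (n + 2))
  rcases closure_L n h1 with h3 | h3
  · have := L_disj h2 h3; omega
  · have := L_disj h2 (A_subset_L _ h3); omega

theorem rigid {S : X → X} (hS : Continuous S) (hmin : IsMinimal S) : ∃ k, S = sh k := by
  have hsurj := surjective_of_minimal hS hmin
  set R : ℤ → ℤ → Prop := fun n m => ∀ x ∈ L n, S x ∈ L m with hR
  have heL : ∀ n, e n ∈ L n := fun n => A_subset_L n (e_mem n)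
  have H1 : ∀ n m x, x ∈ L n → S x ∈ L m → R n m := by
    intro n m x hx hSx y hy
    exact L_of_joined hSx ((joined_L hx hy).map hS)
  have hclR : ∀ n m, R n m → ∀ x ∈ closure (L n), S x ∈ closure (L m) := fun n m h x hx =>
    map_mem_closure hS hx h
  have hex : ∀ m, ∃ n, R n m := by
    intro m
    obtain ⟨x, hx⟩ := hsurj (e m)
    have hx' : S x ∈ L m := by rw [hx]; exact heL m
    by_contra hcon
    push Not at hcon
    have hreg : ∀ n, x ∉ L n := fun n hn => hcon n (H1 n m x hn hx')
    have hd := hsurj.denseRange.dense_image hS (dense_of_regular hreg)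
    refine L_not_dense m (hd.mono ?_)
    rintro _ ⟨y, hy, rfl⟩
    exact L_of_joined hx' (Joined.map hy hS)
  have hun : ∀ n m m', R n m → R n m' → m = m' := fun n m m' h h' =>
    L_disj (h _ (heL n)) (h' _ (heL n))
  have hst : ∀ n m, R n m → R (n + 1) m ∨ R (n + 1) (m + 1) := by
    intro n m h
    have h1 := hclR n m h _ (A_subset_closure n (e_mem (n + 1)))
    rcases closure_L m h1 with h2 | h2
    · exact Or.inl (H1 _ _ _ (heL _) h2)
    · exact Or.inr (H1 _ _ _ (heL _) (A_subset_L _ h2))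
  have hne : ∀ n, ¬ R n n := by
    intro n h
    refine L_not_dense n ((hmin (e n)).mono ?_)
    rintro _ ⟨j, rfl⟩
    induction j with
    | zero => exact heL n
    | succ j ih =>
      simp only [Function.iterate_succ_apply']
      exact h _ ih
  have hA : ∀ n k, R (n - 1) (n - 1 + k) → R n (n + k) → ∀ x ∈ A n, S x ∈ A (n + k) := by
    intro n k h1 h2 x hx
    have h3 : S x ∈ L (n + k) := h2 x (A_subset_L n hx)
    have h4 : x ∈ closure (L (n - 1)) := A_subset_closure (n - 1) (by rwa [sub_add_cancel])
    rcases closure_L _ (hclR _ _ h1 x h4) with h5 | h5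
    · have := L_disj h3 h5; omega
    · have h6 : n - 1 + k + 1 = n + k := by ring
      rwa [h6] at h5
  have key : ∀ n k, R (n - 1) (n - 1 + k) → R n (n + k) →
      (S (sh n (e 0))).1.1 = (sh k (sh n (e 0))).1.1 ∧
      ∀ m, m ≠ n + k → (S (sh n (e 0))).1.2 m = (sh k (sh n (e 0))).1.2 m := by
    intro n k h1 h2
    have h3 : sh n (e 0) ∈ A n := by simpa using sh_e 0 n
    have h4 : (S (sh n (e 0))).1.1 = z (n + k) := hA n k h1 h2 _ h3
    have h5 : (sh k (sh n (e 0))).1.1 = z (n + k) := by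
      have := sh_e 0 (n + k)
      rw [zero_add] at this
      rw [sh_sh]; exact this
    refine ⟨h4.trans h5.symm, fun m hm => ?_⟩
    have hz : z (n + k) ≠ z m := fun h => hm (z_inj h).symm
    rw [((S (sh n (e 0))).2.2 m).2 (by rw [h4]; exact hz),
      ((sh k (sh n (e 0))).2.2 m).2 (by rw [h5]; exact hz), h4, h5]
  obtain ⟨k, N, hkN⟩ := comb hex hun hst hne
  refine ⟨k, funext fun x => ?_⟩
  have hc1 : IsClosed {x : X | (S x).1.1 = (sh k x).1.1} :=
    isClosed_eq (by fun_prop) (by have := sh_continuous k; fun_prop)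
  have hc2 : ∀ m, IsClosed {x : X | (S x).1.2 m = (sh k x).1.2 m} := fun m =>
    isClosed_eq (by fun_prop) (by have := sh_continuous k; fun_prop)
  have aux : ∀ {D C : Set X}, Dense D → IsClosed C → D ⊆ C → x ∈ C := fun hD hC h =>
    (hC.closure_subset_iff.2 h) (hD x)
  refine Subtype.ext (Prod.ext ?_ (funext fun m => ?_))
  · rcases hkN with h | h
    · refine aux (dense_tail_pos (e 0) (N + 1)) hc1 ?_
      rintro _ ⟨n, hn, rfl⟩
      exact (key n k (h _ (by omega)) (h _ (by omega))).1
    · refine aux (dense_tail_neg (e 0) N) hc1 ?_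
      rintro _ ⟨n, hn, rfl⟩
      exact (key n k (h _ (by omega)) (h _ (by omega))).1
  · rcases hkN with h | h
    · refine aux (dense_tail_pos (e 0) (max (N + 1) (m - k + 1))) (hc2 m) ?_
      rintro _ ⟨n, hn, rfl⟩
      exact (key n k (h _ (by omega)) (h _ (by omega))).2 m (by omega)
    · refine aux (dense_tail_neg (e 0) (min N (m - k - 1))) (hc2 m) ?_
      rintro _ ⟨n, hn, rfl⟩
      exact (key n k (h _ (by omega)) (h _ (by omega))).2 m (by omega)

theorem not_circle : ¬ Nonempty (X ≃ₜ (Metric.sphere (0 : ℂ) 1 : Set ℂ)) := by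
  rintro ⟨f⟩
  have hpc : IsPathConnected (Metric.sphere (0 : ℂ) 1) :=
    isPathConnected_sphere (by rw [Complex.rank_real_complex]; norm_num) 0 zero_le_one
  have := isPathConnected_iff_pathConnectedSpace.1 hpc
  have hj : Joined (f (e 0)) (f (e 1)) := PathConnectedSpace.joined _ _
  have hj' := hj.map f.symm.continuous
  simp only [f.symm_apply_apply] at hj'
  have h1 := L_of_joined (A_subset_L 0 (e_mem 0)) hj'
  have := L_disj h1 (A_subset_L 1 (e_mem 1))
  omega

theorem main : CompactSpace X ∧ ConnectedSpace X ∧ Nonempty X ∧ Nontrivial X ∧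
      ¬ Nonempty (X ≃ₜ (Metric.sphere (0 : ℂ) 1 : Set ℂ)) ∧
      (∃ T : X ≃ₜ X, IsMinimal ⇑T) ∧
      ∀ T : X → X, Continuous T → IsMinimal T → IsHomeomorph T := by
  refine ⟨inferInstance, inferInstance, ⟨e 0⟩, ⟨e 0, e 1, fun h => ?_⟩, not_circle,
    ⟨shH 1, sh_isMinimal⟩, fun T hT hm => ?_⟩
  · have h1 := e_mem 1
    rw [← h] at h1
    have := L_disj (A_subset_L 0 (e_mem 0)) (A_subset_L 1 h1)
    omega
  · obtain ⟨k, rfl⟩ := rigid hT hm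
    exact (shH k).isHomeomorph

end Slovak

/-- There exists a non-degenerate continuum, not homeomorphic to the circle, which admits a
minimal homeomorphism but no minimal non-invertible continuous self-map: every minimal
continuous self-map of it is a homeomorphism. -/
theorem exists_type_one_zero_continuum_ne_circle :
    ∃ (X : Type) (_ : MetricSpace X), CompactSpace X ∧ ConnectedSpace X ∧ Nonempty X ∧
      Nontrivial X ∧
      ¬ Nonempty (X ≃ₜ (Metric.sphere (0 : ℂ) 1 : Set ℂ)) ∧
      (∃ T : X ≃ₜ X, IsMinimal ⇑T) ∧
      ∀ T : X → X, Continuous T → IsMinimal T → IsHomeomorph T :=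
  ⟨Slovak.X, TopologicalSpace.metrizableSpaceMetric Slovak.X, Slovak.main⟩
end
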